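/- arXiv:2401.01337 — 4 statements merged into one kernel-verified Lean document; each statement's English description precedes it below -/
import Mathlib

section
/- (Lemma 3.4) Let m ≥ 3 and n be integers with n ≥ 2m−1 and n ≥ m²/4 − 1. Let p* = ⌊(m−1)/2⌋ and let k* be the largest integer k ∈ [p*, n−m+p*] such that C(k, p*) ≤ C(n−k−1, m−p*−1). Then max(C(k*, p*), C(n−k*−2, m−p*−1)) = max over integers p ∈ [1, m−2] and k ∈ [p, n−m+p] of min(C(k, p), C(n−k−1, m−p−1)). -/
/-- `C(a+1,p) (a+1-p) = C(a,p) (a+1)` over the reals. -/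
lemma aux_up (a p : ℕ) :
    (Nat.choose (a + 1) p : ℝ) * ((a : ℝ) + 1 - p) = Nat.choose a p * ((a : ℝ) + 1) := by
  rcases le_or_gt p (a + 1) with h | h
  · have := Nat.choose_mul_succ_eq a p
    have h2 : ((a + 1 - p : ℕ) : ℝ) = (a : ℝ) + 1 - p := by push_cast [Nat.cast_sub h]; ring
    rw [← h2]
    exact_mod_cast this.symm
  · rw [Nat.choose_eq_zero_of_lt h, Nat.choose_eq_zero_of_lt (by omega : a < p)]; simp

/-- `C(a,p+1) (p+1) = C(a,p) (a-p)` over the reals. -/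
lemma aux_right (a p : ℕ) :
    (Nat.choose a (p + 1) : ℝ) * ((p : ℝ) + 1) = Nat.choose a p * ((a : ℝ) - p) := by
  rcases le_or_gt p a with h | h
  · have := Nat.choose_succ_right_eq a p
    rw [← Nat.cast_sub h]
    exact_mod_cast this
  · rw [Nat.choose_eq_zero_of_lt h, Nat.choose_eq_zero_of_lt (by omega : a < p + 1)]; simp

/-- Log-concavity in the upper index. -/
lemma logconc_step (a b p : ℕ) (hab : b ≤ a) :
    Nat.choose (a + 1) p * Nat.choose b p ≤ Nat.choose a p * Nat.choose (b + 1) p := by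
  rcases lt_or_ge b p with h | h
  · rw [Nat.choose_eq_zero_of_lt h]; simp
  have h1 := aux_up a p
  have h2 := aux_up b p
  have hb : (p : ℝ) ≤ b := by exact_mod_cast h
  have ha : (b : ℝ) ≤ a := by exact_mod_cast hab
  have hp0 : (0 : ℝ) ≤ p := by positivity
  have e1 : (Nat.choose (a + 1) p : ℝ) = Nat.choose a p * ((a : ℝ) + 1) / ((a : ℝ) + 1 - p) := by
    rw [eq_div_iff (by linarith)]; exact h1
  have e2 : (Nat.choose (b + 1) p : ℝ) = Nat.choose b p * ((b : ℝ) + 1) / ((b : ℝ) + 1 - p) := by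
    rw [eq_div_iff (by linarith)]; exact h2
  have key : ((a : ℝ) + 1) / ((a : ℝ) + 1 - p) ≤ ((b : ℝ) + 1) / ((b : ℝ) + 1 - p) := by
    rw [div_le_div_iff₀ (by linarith) (by linarith)]
    nlinarith
  have : (Nat.choose (a + 1) p : ℝ) * Nat.choose b p ≤ Nat.choose a p * Nat.choose (b + 1) p := by
    rw [e1, e2, mul_div_assoc, mul_div_assoc]
    have h0 : (0 : ℝ) ≤ (Nat.choose a p : ℝ) * Nat.choose b p := by positivity
    calc _ = ((Nat.choose a p : ℝ) * Nat.choose b p) * (((a : ℝ) + 1) / ((a : ℝ) + 1 - p)) := by ring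
      _ ≤ ((Nat.choose a p : ℝ) * Nat.choose b p) * (((b : ℝ) + 1) / ((b : ℝ) + 1 - p)) :=
        mul_le_mul_of_nonneg_left key h0
      _ = _ := by ring
  exact_mod_cast this

lemma logconc (y p d : ℕ) :
    Nat.choose (y + 2 * d + 1) p * Nat.choose y p ≤
      Nat.choose (y + d + 1) p * Nat.choose (y + d) p := by
  induction d generalizing y with
  | zero => simp
  | succ d ih =>
    have h1 := logconc_step (y + 2 * d + 2) y p (by omega)
    have h2 := ih (y + 1)
    have e1 : y + 2 * (d + 1) + 1 = y + 2 * d + 2 + 1 := by ring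
    have e2 : y + 1 + 2 * d + 1 = y + 2 * d + 2 := by ring
    have e3 : y + 1 + d = y + (d + 1) := by ring
    rw [e2, e3] at h2
    rw [e1]
    exact h1.trans h2

lemma bern (h p j : ℕ) (hp : p ≤ h) :
    ((h : ℝ) + 1 - j * p) * Nat.choose (h + j) p ≤ ((h : ℝ) + 1) * Nat.choose h p := by
  induction j with
  | zero => simp
  | succ j ih =>
    have h1 := aux_up (h + j) p
    have hp' : (p : ℝ) ≤ h := by exact_mod_cast hp
    have hp0 : (0 : ℝ) ≤ p := by positivity
    have hj : (0 : ℝ) ≤ j := by positivity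
    push_cast at h1 ⊢
    refine le_trans ?_ ih
    rw [← add_assoc]
    set c1 : ℝ := ((Nat.choose (h + j + 1) p : ℕ) : ℝ)
    set c0 : ℝ := ((Nat.choose (h + j) p : ℕ) : ℝ)
    have hc1 : 0 ≤ c1 := by positivity
    have hpos : (0 : ℝ) < (h : ℝ) + j + 1 := by positivity
    have e0 : c0 = c1 * ((h : ℝ) + j + 1 - p) / ((h : ℝ) + j + 1) := by
      rw [eq_div_iff hpos.ne']; linarith
    have key : ((h : ℝ) + 1 - (j + 1) * p) ≤
        ((h : ℝ) + 1 - j * p) * (((h : ℝ) + j + 1 - p) / ((h : ℝ) + j + 1)) := by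
      rw [← mul_div_assoc, le_div_iff₀ hpos]
      nlinarith [mul_nonneg hj hp0, mul_nonneg (mul_nonneg hj hp0) hp0]
    calc _ ≤ (((h : ℝ) + 1 - j * p) * (((h : ℝ) + j + 1 - p) / ((h : ℝ) + j + 1))) * c1 :=
          mul_le_mul_of_nonneg_right key hc1
      _ = _ := by rw [e0]; ring

lemma poly (p s d : ℝ) (hp : 1 ≤ p) (hs : p * (p + 1) ≤ 2 * s) (hd : p ≤ 4 * d + 2)
    (hsd : d + 1 ≤ s) :
    (s + p + 1) * (p + 1) * ((s - d) * (s - d - 1)) ≤ (s + 1) * (p + 2) * s ^ 2 := by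
  have h1 : (s - d) * (s - d - 1) ≤ (s - p / 4) ^ 2 - 1 / 4 := by nlinarith
  have hspos : 0 < s := by nlinarith
  refine (mul_le_mul_of_nonneg_left h1 (by positivity)).trans ?_
  obtain ⟨t, ht⟩ : ∃ t, s = p * (p + 1) / 2 + t := ⟨s - p * (p + 1) / 2, by ring⟩
  have ht0 : 0 ≤ t := by linarith
  have e : (s + 1) * (p + 2) * s ^ 2 - (s + p + 1) * (p + 1) * ((s - p / 4) ^ 2 - 1 / 4)
      = s ^ 2 * (1 + t) + (p + 1) ^ 2 * (p / 2) * s + (s + p + 1) * (p + 1) * (1 / 4 - p ^ 2 / 16) := by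
    have : t = s - p * (p + 1) / 2 := by linarith
    rw [this]; ring
  have hps : p ≤ s := by nlinarith
  have h2 : (s + p + 1) * (p + 1) * (p ^ 2 / 16) ≤ (p + 1) ^ 2 * (p / 2) * s := by
    have a1 : s + p + 1 ≤ 3 * s := by nlinarith
    calc _ ≤ (3 * s) * (p + 1) * (p ^ 2 / 16) := by gcongr
      _ = (p + 1) * (p / 2) * s * (3 * p / 8) := by ring
      _ ≤ (p + 1) * (p / 2) * s * (p + 1) := by gcongr; linarith
      _ = _ := by ring
  have h3 : 0 ≤ s ^ 2 * (1 + t) := by positivity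
  have h4 : 0 ≤ (s + p + 1) * (p + 1) * (1 / 4) := by positivity
  nlinarith

/-- The core inequality. -/
lemma core (p y d : ℕ) (hp : 1 ≤ p) (h1 : p * (p + 3) ≤ 2 * (y + d)) (h2 : 2 * p + 1 ≤ y + d)
    (hb : Nat.choose (y + d) (p + 1) < Nat.choose (y + 2 * d + 1) p)
    (ha : Nat.choose (y + d) (p + 1) < Nat.choose y (p + 2)) : False := by
  have hy : p + 2 ≤ y := by
    by_contra hc
    rw [Nat.choose_eq_zero_of_lt (by omega : y < p + 2)] at ha
    omega
  have hyR : (p : ℝ) + 2 ≤ y := by exact_mod_cast hy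
  have hpR : (1 : ℝ) ≤ p := by exact_mod_cast hp
  have hdR : (0 : ℝ) ≤ d := by positivity
  have h1R : (p : ℝ) * (p + 3) ≤ 2 * (y + d) := by exact_mod_cast h1
  have h2R : 2 * (p : ℝ) + 1 ≤ y + d := by exact_mod_cast h2
  have r1 := aux_right (y + d) p
  push_cast at r1
  have hcpos : (0 : ℝ) < Nat.choose (y + d) p := by
    exact_mod_cast Nat.choose_pos (by omega : p ≤ y + d)
  have hbR : (Nat.choose (y + d) (p + 1) : ℝ) < Nat.choose (y + 2 * d + 1) p := by exact_mod_cast hb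
  have haR : (Nat.choose (y + d) (p + 1) : ℝ) < Nat.choose y (p + 2) := by exact_mod_cast ha
  by_cases hd : p ≤ 4 * d + 2
  · have hd' : (p : ℝ) ≤ 4 * d + 2 := by exact_mod_cast hd
    have hpoly := poly p ((y : ℝ) + d - p) d hpR (by nlinarith) hd' (by linarith)
    have lc := logconc y p d
    have lcR : (Nat.choose (y + 2 * d + 1) p : ℝ) * Nat.choose y p ≤
      Nat.choose (y + d + 1) p * Nat.choose (y + d) p := by exact_mod_cast lc
    have u1 := aux_up (y + d) p
    have r2 := aux_right y p
    have r3 := aux_right y (p + 1)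
    push_cast at u1 r3
    rw [show p + 1 + 1 = p + 2 by ring] at r3
    set A : ℝ := ((Nat.choose (y + d) (p + 1) : ℕ) : ℝ)
    set B : ℝ := ((Nat.choose (y + 2 * d + 1) p : ℕ) : ℝ)
    set C : ℝ := ((Nat.choose y (p + 2) : ℕ) : ℝ)
    set c : ℝ := ((Nat.choose (y + d) p : ℕ) : ℝ)
    set c1 : ℝ := ((Nat.choose (y + d + 1) p : ℕ) : ℝ)
    set e : ℝ := ((Nat.choose y p : ℕ) : ℝ)
    set e1 : ℝ := ((Nat.choose y (p + 1) : ℕ) : ℝ)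
    have hA0 : 0 ≤ A := by positivity
    have hAA : A * A < B * C := mul_lt_mul'' hbR haR hA0 hA0
    have hs : (0:ℝ) < (y : ℝ) + d - p := by linarith
    -- C (p+1)(p+2) = e (y-p)(y-p-1)
    have hC : C * (((p : ℝ) + 1) * (p + 2)) = e * ((y - p) * (y - p - 1)) := by
      calc C * (((p : ℝ) + 1) * (p + 2)) = (C * (p + 1 + 1)) * (p + 1) := by ring
        _ = (e1 * (p + 1)) * (y - (p + 1)) := by rw [r3]; ring
        _ = _ := by rw [r2]; ring
    have q1 : A * A * (((p : ℝ) + 1) ^ 2 * (p + 2) * (y + d + 1 - p)) <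
        B * C * (((p : ℝ) + 1) ^ 2 * (p + 2) * (y + d + 1 - p)) :=
      mul_lt_mul_of_pos_right hAA (by
        have : (0:ℝ) < y + d + 1 - p := by linarith
        positivity)
    have q2 : A * A * (((p : ℝ) + 1) ^ 2 * (p + 2) * (y + d + 1 - p))
        = c ^ 2 * ((y + d - p + 1) * (p + 2) * ((y : ℝ) + d - p) ^ 2) := by
      calc _ = (A * (p + 1)) ^ 2 * ((p + 2) * (y + d + 1 - p)) := by ring
        _ = _ := by rw [r1]; ring
    have q3 : B * C * (((p : ℝ) + 1) ^ 2 * (p + 2) * (y + d + 1 - p))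
        ≤ c ^ 2 * ((y + d - p + p + 1) * (p + 1) * (((y : ℝ) + d - p - d) * (y + d - p - d - 1))) := by
      have hw : (0:ℝ) ≤ (y - p) * (y - p - 1) * ((p + 1) * (y + d + 1 - p)) := by
        have a1 : (0:ℝ) ≤ y - p := by linarith
        have a2 : (0:ℝ) ≤ y - p - 1 := by linarith
        have a3 : (0:ℝ) ≤ y + d + 1 - p := by linarith
        positivity
      calc _ = B * (C * (((p : ℝ) + 1) * (p + 2))) * ((p + 1) * (y + d + 1 - p)) := by ring
        _ = (B * e) * ((y - p) * (y - p - 1) * ((p + 1) * (y + d + 1 - p))) := by rw [hC]; ring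
        _ ≤ (c1 * c) * ((y - p) * (y - p - 1) * ((p + 1) * (y + d + 1 - p))) :=
          mul_le_mul_of_nonneg_right lcR hw
        _ = (c1 * (y + d + 1 - p)) * (c * ((y - p) * (y - p - 1) * (p + 1))) := by ring
        _ = _ := by rw [u1]; ring
    have q4 := mul_le_mul_of_nonneg_left hpoly (sq_nonneg c)
    linarith
  · push Not at hd
    by_cases hp3 : p = 3
    · have hd0 : d = 0 := by omega
      subst hp3 hd0
      have u1 := aux_up y 3
      simp only [add_zero, mul_zero] at *
      push_cast at *
      have : (9:ℝ) ≤ y := by linarith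
      set A : ℝ := ((Nat.choose y (3 + 1) : ℕ) : ℝ)
      set c : ℝ := ((Nat.choose y 3 : ℕ) : ℝ)
      set B : ℝ := ((Nat.choose (y + 1) 3 : ℕ) : ℝ)
      have : A * 4 * (y - 2) = c * (y - 3) * (y - 2) := by
        linear_combination ((y:ℝ) - 2) * r1
      have h5 : B * (y - 2) = c * (y + 1) := by rw [← u1]; ring
      have h6 : A * (y - 2) < B * (y - 2) := mul_lt_mul_of_pos_right hbR (by linarith)
      have h7 : c * ((y - 3) * (y - 2)) < c * (4 * (y + 1)) := by linarith
      have h8 := lt_of_mul_lt_mul_left h7 hcpos.le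
      nlinarith
    · have hp4 : 4 ≤ p := by omega
      have hp4R : (4 : ℝ) ≤ p := by exact_mod_cast hp4
      have hd4 : 4 * (d : ℝ) + 3 ≤ p := by exact_mod_cast (by omega : 4 * d + 3 ≤ p)
      have hbn := bern (y + d) p (d + 1) (by omega)
      rw [show y + d + (d + 1) = y + 2 * d + 1 by ring] at hbn
      push_cast at hbn
      set A : ℝ := ((Nat.choose (y + d) (p + 1) : ℕ) : ℝ)
      set c : ℝ := ((Nat.choose (y + d) p : ℕ) : ℝ)
      set B : ℝ := ((Nat.choose (y + 2 * d + 1) p : ℕ) : ℝ)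
      have hB0 : 0 ≤ B := by positivity
      have hhalf : ((y : ℝ) + d + 1) / 2 ≤ y + d + 1 - (d + 1) * p := by nlinarith
      have hBc : B ≤ 2 * c := by
        have h3 := (mul_le_mul_of_nonneg_right hhalf hB0).trans hbn
        have hpos : (0:ℝ) < (y : ℝ) + d + 1 := by positivity
        have : ((y : ℝ) + d + 1) * B ≤ ((y : ℝ) + d + 1) * (2 * c) := by linarith
        exact le_of_mul_le_mul_left this hpos
      have h4 : c * ((y : ℝ) + d - p) < c * (2 * (p + 1)) := by
        rw [← r1]
        have : A * ((p : ℝ) + 1) < (2 * c) * (p + 1) :=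
          mul_lt_mul_of_pos_right (by linarith) (by positivity)
        linarith
      have h5 := lt_of_mul_lt_mul_left h4 hcpos.le
      nlinarith

lemma desc_r (Y y r : ℕ) (hY : y ≤ Y)
    (h : Nat.choose Y (r + 1) < Nat.choose y (r + 2)) :
    Nat.choose Y r < Nat.choose y (r + 1) := by
  have hy : r + 2 ≤ y := by
    by_contra hc
    rw [Nat.choose_eq_zero_of_lt (by omega : y < r + 2)] at h
    omega
  have r1 := aux_right Y r
  have r2 := aux_right y (r + 1)
  rw [show r + 1 + 1 = r + 2 by ring] at r2
  push_cast at r2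
  have hyR : (r : ℝ) + 2 ≤ y := by exact_mod_cast hy
  have hYR : (y : ℝ) ≤ Y := by exact_mod_cast hY
  have hr : (0 : ℝ) ≤ r := by positivity
  have hR : (Nat.choose Y (r + 1) : ℝ) < Nat.choose y (r + 2) := by exact_mod_cast h
  suffices (Nat.choose Y r : ℝ) < Nat.choose y (r + 1) by exact_mod_cast this
  set a : ℝ := ((Nat.choose Y r : ℕ) : ℝ)
  set b : ℝ := ((Nat.choose y (r + 1) : ℕ) : ℝ)
  set a1 : ℝ := ((Nat.choose Y (r + 1) : ℕ) : ℝ)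
  set b1 : ℝ := ((Nat.choose y (r + 2) : ℕ) : ℝ)
  have hb : 0 ≤ b := by positivity
  have s1 : a1 * (r + 1) < b1 * (r + 1) := mul_lt_mul_of_pos_right hR (by positivity)
  have s2 : b1 * (r + 1) ≤ b1 * (r + 1 + 1) := by
    have : 0 ≤ b1 := by positivity
    nlinarith
  have s3 : b * ((y : ℝ) - (r + 1)) ≤ b * (Y - r) := mul_le_mul_of_nonneg_left (by linarith) hb
  have s4 : a * ((Y : ℝ) - r) < b * (Y - r) := by linarith
  exact lt_of_mul_lt_mul_right s4 (by linarith)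

lemma desc_r' (Y y p j : ℕ) (hY : y ≤ Y)
    (h : Nat.choose Y (p + 1 + j) < Nat.choose y (p + 2 + j)) :
    Nat.choose Y (p + 1) < Nat.choose y (p + 2) := by
  induction j with
  | zero => simpa using h
  | succ j ih =>
    apply ih
    have := desc_r Y y (p + 1 + j) hY (by
      convert h using 2 <;> ring)
    convert this using 2
    ring

lemma desc_x (z D p : ℕ) (h : Nat.choose (z + 1) (p + 1) < Nat.choose (z + 1 + D) p) :
    Nat.choose z (p + 1) < Nat.choose (z + D) p ∨ z + D < p := by
  rcases le_or_gt z p with hz | hz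
  · rcases lt_or_ge (z + D) p with h' | h'
    · exact Or.inr h'
    · left
      rw [Nat.choose_eq_zero_of_lt (by omega : z < p + 1)]
      exact Nat.choose_pos h'
  left
  have u1 := aux_up z (p + 1)
  have u2 := aux_up (z + D) p
  rw [show z + D + 1 = z + 1 + D by ring] at u2
  push_cast at u1 u2
  have hzR : (p : ℝ) + 1 ≤ z := by exact_mod_cast hz
  have hR : (Nat.choose (z + 1) (p + 1) : ℝ) < Nat.choose (z + 1 + D) p := by exact_mod_cast h
  suffices (Nat.choose z (p + 1) : ℝ) < Nat.choose (z + D) p by exact_mod_cast this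
  have hp : (0 : ℝ) ≤ p := by positivity
  have hD : (0 : ℝ) ≤ D := by positivity
  set a : ℝ := ((Nat.choose z (p + 1) : ℕ) : ℝ)
  set b : ℝ := ((Nat.choose (z + D) p : ℕ) : ℝ)
  set a1 : ℝ := ((Nat.choose (z + 1) (p + 1) : ℕ) : ℝ)
  set b1 : ℝ := ((Nat.choose (z + 1 + D) p : ℕ) : ℝ)
  have ha : 0 ≤ a := by positivity
  by_contra hc
  push Not at hc
  -- a (z+1) (z+1+D-p) = a1 (z-p)(z+1+D-p) < b1 (z+1+D-p)(z-p) = b (z+D+1)(z-p)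
  have hpos : (0:ℝ) < (z - p) * (z + 1 + D - p) := mul_pos (by linarith) (by linarith)
  have s1 := mul_lt_mul_of_pos_right hR hpos
  have s2 : a1 * ((z - p) * (z + 1 + D - p)) = a * ((z + 1) * (z + 1 + D - p)) := by
    calc _ = (a1 * (z + 1 - (p + 1))) * (z + 1 + D - p) := by ring
      _ = _ := by rw [u1]; ring
  have s3 : b1 * ((z - p) * (z + 1 + D - p)) = b * ((z + D + 1) * (z - p)) := by
    calc _ = (b1 * (z + D + 1 - p)) * (z - p) := by ring
      _ = _ := by rw [u2]; ring
  have s4 : b * (((z:ℝ) + D + 1) * (z - p)) ≤ a * ((z + D + 1) * (z - p)) :=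
    mul_le_mul_of_nonneg_right hc (mul_nonneg (by positivity) (by linarith))
  have s5 : a * (((z:ℝ) + D + 1) * (z - p)) ≤ a * ((z + 1) * (z + 1 + D - p)) :=
    mul_le_mul_of_nonneg_left (by nlinarith [mul_nonneg hp hD]) ha
  linarith

lemma desc_x' (z D p j : ℕ) (hzp : p ≤ z)
    (h : Nat.choose (z + j) (p + 1) < Nat.choose (z + j + D) p) :
    Nat.choose z (p + 1) < Nat.choose (z + D) p := by
  induction j with
  | zero => simpa using h
  | succ j ih =>
    rcases desc_x (z + j) D p h with h' | h'
    · exact ih h'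
    · omega

lemma asc_y (y d p : ℕ) (h : Nat.choose (y + d) (p + 1) < Nat.choose y (p + 2)) :
    Nat.choose (y + 1 + d) (p + 1) < Nat.choose (y + 1) (p + 2) := by
  have hy : p + 2 ≤ y := by
    by_contra hc
    rw [Nat.choose_eq_zero_of_lt (by omega : y < p + 2)] at h
    omega
  have u1 := aux_up (y + d) (p + 1)
  have u2 := aux_up y (p + 2)
  rw [show y + d + 1 = y + 1 + d by ring] at u1
  push_cast at u1 u2
  have hyR : (p : ℝ) + 2 ≤ y := by exact_mod_cast hy
  have hR : (Nat.choose (y + d) (p + 1) : ℝ) < Nat.choose y (p + 2) := by exact_mod_cast h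
  suffices (Nat.choose (y + 1 + d) (p + 1) : ℝ) < Nat.choose (y + 1) (p + 2) by exact_mod_cast this
  have hp : (0 : ℝ) ≤ p := by positivity
  have hD : (0 : ℝ) ≤ d := by positivity
  set a : ℝ := ((Nat.choose (y + d) (p + 1) : ℕ) : ℝ)
  set b : ℝ := ((Nat.choose y (p + 2) : ℕ) : ℝ)
  set a1 : ℝ := ((Nat.choose (y + 1 + d) (p + 1) : ℕ) : ℝ)
  set b1 : ℝ := ((Nat.choose (y + 1) (p + 2) : ℕ) : ℝ)
  have ha : 0 ≤ a := by positivity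
  have hb : 0 ≤ b := by positivity
  have e1 : a1 = a * (((y:ℝ) + d + 1) / (y + d - p)) := by
    rw [← mul_div_assoc, eq_div_iff (by linarith)]; linarith
  have e2 : b1 = b * (((y:ℝ) + 1) / (y - p - 1)) := by
    rw [← mul_div_assoc, eq_div_iff (by linarith)]; linarith
  have hpos : 0 < ((y:ℝ) + 1) / (y - p - 1) := div_pos (by linarith) (by linarith)
  have key : ((y:ℝ) + d + 1) / (y + d - p) ≤ ((y:ℝ) + 1) / (y - p - 1) := by
    rw [div_le_div_iff₀ (by linarith) (by linarith)]
    nlinarith [mul_nonneg hp hD]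
  rw [e1, e2]
  calc _ ≤ a * (((y:ℝ) + 1) / (y - p - 1)) := mul_le_mul_of_nonneg_left key ha
    _ < _ := mul_lt_mul_of_pos_right hR hpos

lemma asc_y' (y d p j : ℕ) (h : Nat.choose (y + d) (p + 1) < Nat.choose y (p + 2)) :
    Nat.choose (y + j + d) (p + 1) < Nat.choose (y + j) (p + 2) := by
  induction j with
  | zero => simpa using h
  | succ j ih => exact asc_y (y + j) d p ih

lemma choose_mono_half (Y a b : ℕ) (hab : a ≤ b) (hb : 2 * b ≤ Y) :
    Nat.choose Y a ≤ Nat.choose Y b := by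
  induction b, hab using Nat.le_induction with
  | base => exact le_rfl
  | succ b hab ih =>
    exact (ih (by omega)).trans (Nat.choose_le_succ_of_lt_half_left (by omega))

/-- One step towards the middle; here the second lower index is `p + 2 + j`. -/
lemma step (p j x y A : ℕ) (hp : 1 ≤ p) (hN1 : 2 * (p + (p + 2 + j)) ≤ x + y)
    (hN2 : (p + (p + 2 + j) + 1) ^ 2 ≤ 4 * (x + y + 2))
    (hA : 0 < A) (hx : A ≤ Nat.choose x p) (hy : A ≤ Nat.choose y (p + 2 + j)) :
    ∃ x' y', x' + y' = x + y ∧ A ≤ Nat.choose x' (p + 1) ∧ A ≤ Nat.choose y' (p + 1 + j) := by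
  by_cases hx2 : x ≤ 2 * p
  · refine ⟨2 * p + 2, x + y - (2 * p + 2), by omega, ?_, ?_⟩
    · calc A ≤ Nat.choose x p := hx
        _ ≤ Nat.choose (2 * (p + 1)) p := Nat.choose_le_choose p (by omega)
        _ ≤ Nat.choose (2 * (p + 1)) (2 * (p + 1) / 2) := Nat.choose_le_middle _ _
        _ = _ := by congr 1; omega
    · calc A ≤ Nat.choose x p := hx
        _ ≤ Nat.choose (2 * (p + 1 + j)) p := Nat.choose_le_choose p (by omega)
        _ ≤ Nat.choose (2 * (p + 1 + j)) (2 * (p + 1 + j) / 2) := Nat.choose_le_middle _ _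
        _ = Nat.choose (2 * (p + 1 + j)) (p + 1 + j) := by congr 1; omega
        _ ≤ _ := Nat.choose_le_choose _ (by omega)
  push Not at hx2
  have hxp : Nat.choose x p ≤ Nat.choose x (p + 1) := by
    have r1 := Nat.choose_succ_right_eq x p
    have h1 : Nat.choose x p * (p + 1) ≤ Nat.choose x (p + 1) * (p + 1) := by
      rw [r1]; exact Nat.mul_le_mul_left _ (by omega)
    exact Nat.le_of_mul_le_mul_right h1 (by omega)
  obtain ⟨d, hd1, hd2⟩ : ∃ d, A ≤ Nat.choose (x - d) (p + 1) ∧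
      Nat.choose (x - (d + 1)) (p + 1) < A := by
    by_contra hc
    push Not at hc
    have hall : ∀ d, A ≤ Nat.choose (x - d) (p + 1) := by
      intro d
      induction d with
      | zero => exact hx.trans hxp
      | succ d ih => exact hc d ih
    have := hall x
    simp at this
    omega
  by_cases hyd : A ≤ Nat.choose (y + d) (p + 1 + j)
  · have hdx : d ≤ x := by
      by_contra hc
      rw [Nat.sub_eq_zero_of_le (by omega)] at hd1
      simp at hd1
      omega
    exact ⟨x - d, y + d, by omega, hd1, hyd⟩
  exfalso
  push Not at hyd
  have hdx : p + 1 ≤ x - d := by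
    by_contra hc
    rw [Nat.choose_eq_zero_of_lt (by omega)] at hd1
    omega
  -- `y ≥ 2 r`
  have hy2 : 2 * (p + 2 + j) ≤ y := by
    by_contra hc
    have r1 := Nat.choose_succ_right_eq y (p + 1 + j)
    have h1 : Nat.choose y (p + 1 + j + 1) * (p + 1 + j + 1) ≤
        Nat.choose y (p + 1 + j) * (p + 1 + j + 1) := by
      rw [r1]; exact Nat.mul_le_mul_left _ (by omega)
    have h2 := Nat.le_of_mul_le_mul_right h1 (by omega)
    rw [show p + 1 + j + 1 = p + 2 + j by ring] at h2
    have h3 : Nat.choose y (p + 1 + j) ≤ Nat.choose (y + d) (p + 1 + j) :=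
      Nat.choose_le_choose _ (by omega)
    omega
  have hxy : y + 2 * d + 1 ≤ x := by
    by_contra hc
    have h1 : Nat.choose (x - d) (p + 1) ≤ Nat.choose (y + d) (p + 1) :=
      Nat.choose_le_choose _ (by omega)
    have h2 := choose_mono_half (y + d) (p + 1) (p + 1 + j) (by omega) (by omega)
    omega
  have ha := desc_r' (y + d) y p j (by omega) (lt_of_lt_of_le hyd hy)
  have hb : Nat.choose (x - (d + 1)) (p + 1) < Nat.choose x p := lt_of_lt_of_le hd2 hx
  have hq : p * (p + 3) + 1 ≤ x + y := by nlinarith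
  have heven : Even (p * (p + 3)) := by
    rcases Nat.even_or_odd p with h | h
    · exact h.mul_right _
    · exact (h.add_odd (by decide)).mul_left _
  obtain ⟨w, hw⟩ := heven
  obtain ⟨h, hh⟩ : ∃ h, h = (x + y - 1) / 2 := ⟨_, rfl⟩
  obtain ⟨i, hi⟩ : ∃ i, y + i + d = h := ⟨h - d - y, by omega⟩
  obtain ⟨l, hl⟩ : ∃ l, h + l + (d + 1) = x := ⟨x - (d + 1) - h, by omega⟩
  have ha' := asc_y' y d p i ha
  have hb' := desc_x' h (d + 1) p l (by omega) (by
    rw [hl, show h + l = x - (d + 1) by omega]; exact hb)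
  refine core p (y + i) d hp (by omega) (by omega) ?_ ha'
  rw [hi]
  rwa [show y + i + 2 * d + 1 = h + (d + 1) by omega]

lemma iter (t p M N x y A q : ℕ) (hp : 1 ≤ p) (hq : p + t = q) (hM : 2 * q ≤ M)
    (hN1 : 2 * M ≤ N) (hN2 : (M + 1) ^ 2 ≤ 4 * (N + 2)) (hxy : x + y = N)
    (hA : 0 < A) (hx : A ≤ Nat.choose x p) (hy : A ≤ Nat.choose y (M - p)) :
    ∃ x' y', x' + y' = N ∧ A ≤ Nat.choose x' q ∧ A ≤ Nat.choose y' (M - q) := by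
  induction t generalizing p x y with
  | zero =>
    have : p = q := by omega
    subst this
    exact ⟨x, y, hxy, hx, hy⟩
  | succ t ih =>
    obtain ⟨j, hj⟩ : ∃ j, M - p = p + 2 + j := ⟨M - p - (p + 2), by omega⟩
    have hM' : p + (p + 2 + j) = M := by omega
    obtain ⟨x', y', h1, h2, h3⟩ := step p j x y A hp (by rw [hM', hxy]; exact hN1)
      (by rw [hM', hxy]; exact hN2) hA hx (by rw [← hj]; exact hy)
    exact ih (p + 1) x' y' (by omega) (by omega) (by omega) h2
      (by rwa [show M - (p + 1) = p + 1 + j by omega])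

/-- Lemma 3.4: for integers `m ≥ 3` and `n` with `n ≥ 2m - 1` and
`n ≥ m²/4 - 1`, letting `p* = ⌊(m-1)/2⌋` and `k*` the largest integer
`k ∈ [p*, n - m + p*]` with `C(k, p*) ≤ C(n-k-1, m-p*-1)`, one has
`max (C(k*, p*)) (C(n-k*-2, m-p*-1))
  = max_{1 ≤ p ≤ m-2} max_{p ≤ k ≤ n-m+p} min (C(k,p)) (C(n-k-1, m-p-1))`. -/
theorem max_computable_rank_eq
    (m n : ℕ) (hm : 3 ≤ m) (hn1 : 2 * m - 1 ≤ n)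
    (hn2 : (m : ℝ) ^ 2 / 4 - 1 ≤ (n : ℝ))
    (pstar kstar : ℕ) (hpstar : pstar = (m - 1) / 2)
    (hk0 : pstar ≤ kstar) (hk1 : kstar ≤ n - m + pstar)
    (hk2 : Nat.choose kstar pstar ≤ Nat.choose (n - kstar - 1) (m - pstar - 1))
    (hk3 : ∀ k : ℕ, pstar ≤ k → k ≤ n - m + pstar →
      Nat.choose k pstar ≤ Nat.choose (n - k - 1) (m - pstar - 1) → k ≤ kstar) :
    max (Nat.choose kstar pstar) (Nat.choose (n - kstar - 2) (m - pstar - 1)) =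
      (Finset.Icc 1 (m - 2)).sup fun p =>
        (Finset.Icc p (n - m + p)).sup fun k =>
          min (Nat.choose k p) (Nat.choose (n - k - 1) (m - p - 1)) := by
  have hn2' : m ^ 2 ≤ 4 * (n + 1) := by
    have : (m : ℝ) ^ 2 ≤ 4 * (n + 1) := by linarith
    exact_mod_cast this
  apply le_antisymm
  · have hps1 : pstar ∈ Finset.Icc 1 (m - 2) := by rw [Finset.mem_Icc]; omega
    have key : ∀ k ∈ Finset.Icc pstar (n - m + pstar),
        min (Nat.choose k pstar) (Nat.choose (n - k - 1) (m - pstar - 1)) ≤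
        (Finset.Icc 1 (m - 2)).sup fun p =>
        (Finset.Icc p (n - m + p)).sup fun k =>
          min (Nat.choose k p) (Nat.choose (n - k - 1) (m - p - 1)) := by
      intro k hk
      refine le_trans ?_ (Finset.le_sup (f := fun p =>
        (Finset.Icc p (n - m + p)).sup fun k =>
          min (Nat.choose k p) (Nat.choose (n - k - 1) (m - p - 1))) hps1)
      exact Finset.le_sup (f := fun k =>
        min (Nat.choose k pstar) (Nat.choose (n - k - 1) (m - pstar - 1))) hk
    apply max_le
    · have := key kstar (by rw [Finset.mem_Icc]; omega)
      rwa [min_eq_left hk2] at this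
    · by_cases hlt : kstar + 1 ≤ n - m + pstar
      · have h1 := key (kstar + 1) (by rw [Finset.mem_Icc]; omega)
        rw [show n - (kstar + 1) - 1 = n - kstar - 2 by omega] at h1
        have h2 : ¬ Nat.choose (kstar + 1) pstar ≤
            Nat.choose (n - (kstar + 1) - 1) (m - pstar - 1) := by
          intro h
          have := hk3 (kstar + 1) (by omega) hlt h
          omega
        rw [show n - (kstar + 1) - 1 = n - kstar - 2 by omega] at h2
        rwa [min_eq_right (by omega)] at h1
      · rw [Nat.choose_eq_zero_of_lt (by omega : n - kstar - 2 < m - pstar - 1)]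
        exact Nat.zero_le _
  · apply Finset.sup_le
    intro p hp
    apply Finset.sup_le
    intro k hk
    rw [Finset.mem_Icc] at hp hk
    obtain ⟨A, hAdef⟩ : ∃ A, A = min (Nat.choose k p) (Nat.choose (n - k - 1) (m - p - 1)) :=
      ⟨_, rfl⟩
    rw [← hAdef]
    rcases Nat.eq_zero_or_pos A with hA0 | hA
    · rw [hA0]; exact Nat.zero_le _
    have hx : A ≤ Nat.choose k p := hAdef ▸ min_le_left _ _
    have hy : A ≤ Nat.choose (n - k - 1) (m - p - 1) := hAdef ▸ min_le_right _ _
    have hN2 : (m - 1 + 1) ^ 2 ≤ 4 * (n - 1 + 2) := by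
      rw [show m - 1 + 1 = m by omega, show n - 1 + 2 = n + 1 by omega]; exact hn2'
    obtain ⟨x', y', h1, h2, h3⟩ : ∃ x' y', x' + y' = n - 1 ∧ A ≤ Nat.choose x' pstar ∧
        A ≤ Nat.choose y' (m - 1 - pstar) := by
      by_cases hpp : p ≤ pstar
      · exact iter (pstar - p) p (m - 1) (n - 1) k (n - k - 1) A pstar (by omega) (by omega)
          (by omega) (by omega) hN2 (by omega) hA hx
          (by rwa [show m - 1 - p = m - p - 1 by omega])
      · exact iter (pstar - (m - p - 1)) (m - p - 1) (m - 1) (n - 1) (n - k - 1) k A pstar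
          (by omega) (by omega) (by omega) (by omega) hN2 (by omega) hA hy
          (by rwa [show m - 1 - (m - p - 1) = p by omega])
    rcases le_or_gt x' kstar with hle | hgt
    · exact le_max_of_le_left (h2.trans (Nat.choose_le_choose _ hle))
    · apply le_max_of_le_right
      rw [show m - 1 - pstar = m - pstar - 1 by omega] at h3
      exact h3.trans (Nat.choose_le_choose _ (by omega))
end

section
/- (Theorem 3.5) Let m ≥ 3 and n be integers with n ≥ 2m−1 and n ≥ m²/4 − 1. Let p* = ⌊(m−1)/2⌋ and let k* be the largest integer k ∈ [p*, n−m+p*] such that C(k, p*) ≤ C(n−k−1, m−p*−1). Then the largest rank computable by the algorithm, r_max = max over integers p ∈ [1, m−2] and k ∈ [p+1, n−m+p−1] of min(C(k, p), C(n−k−1, m−p−1)), satisfies r_max = max(C(k*, p*), C(n−2−k*, m−1−p*)). -/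
lemma choose_le_aux {a b y : ℕ} (hab : a ≤ b) (h : a + b ≤ y) :
    y.choose a ≤ y.choose b := by
  have h1 := Nat.choose_mul (n := y) (k := b) (s := a) hab
  have h2 : b.choose a ≤ (y - a).choose (b - a) := by
    rw [← Nat.choose_symm hab]
    exact Nat.choose_le_choose _ (by omega)
  have h3 : 0 < b.choose a := Nat.choose_pos hab
  by_contra hc
  push Not at hc
  have h4 : y.choose b * b.choose a < y.choose a * b.choose a :=
    Nat.mul_lt_mul_of_pos_right hc h3
  have h5 := Nat.mul_le_mul_left (y.choose a) h2
  omega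

/-- Pascal quotient in `n`, over the reals. -/
lemma choose_top_real (n k : ℕ) (h : k ≤ n + 1) :
    (((n + 1).choose k : ℕ) : ℝ) * ((n : ℝ) + 1 - k) = (n.choose k : ℕ) * ((n : ℝ) + 1) := by
  have h1 := Nat.choose_mul_succ_eq n k
  have h2 : ((n + 1 - k : ℕ) : ℝ) = (n : ℝ) + 1 - k := by
    rw [Nat.cast_sub h]; push_cast; ring
  rw [← h2]
  exact_mod_cast h1.symm

lemma choose_bot_real (n k : ℕ) (h : k ≤ n) :
    ((n.choose (k + 1) : ℕ) : ℝ) * ((k : ℝ) + 1) = (n.choose k : ℕ) * ((n : ℝ) - k) := by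
  have h1 := Nat.choose_succ_right_eq n k
  rw [← Nat.cast_sub h]
  exact_mod_cast h1

/-- upper growth bound, `X = Z + 1` -/
lemma growth_upper (Z α k : ℕ) (h : α < Z + 1) :
    (((Z + k).choose α : ℕ) : ℝ) ≤
      (((Z : ℝ) + 1) / ((Z : ℝ) + 1 - α)) ^ k * (Z.choose α : ℕ) := by
  have hZ : (α : ℝ) < (Z : ℝ) + 1 := by exact_mod_cast h
  induction k with
  | zero => simp
  | succ k ih =>
    have e := choose_top_real (Z + k) α (by omega)
    push_cast at e
    have hk : (0 : ℝ) ≤ k := Nat.cast_nonneg k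
    have hα : (0 : ℝ) ≤ α := Nat.cast_nonneg α
    have hpos : (0 : ℝ) < (Z : ℝ) + k + 1 - α := by linarith
    have e2 : (((Z + k + 1).choose α : ℕ) : ℝ) =
        ((Z + k).choose α : ℕ) * (((Z : ℝ) + k + 1) / ((Z : ℝ) + k + 1 - α)) := by
      rw [← mul_div_assoc, eq_div_iff hpos.ne']; exact e
    have e3 : ((Z : ℝ) + k + 1) / ((Z : ℝ) + k + 1 - α) ≤ ((Z : ℝ) + 1) / ((Z : ℝ) + 1 - α) := by
      rw [div_le_div_iff₀ hpos (by linarith)]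
      nlinarith [mul_nonneg hk hα]
    rw [← add_assoc, e2, pow_succ]
    calc _ ≤ ((((Z : ℝ) + 1) / ((Z : ℝ) + 1 - α)) ^ k * (Z.choose α : ℕ)) *
          (((Z : ℝ) + 1) / ((Z : ℝ) + 1 - α)) :=
          mul_le_mul ih e3 (div_nonneg (by positivity) hpos.le)
            (mul_nonneg (pow_nonneg (div_nonneg (by positivity) (by linarith)) _)
              (Nat.cast_nonneg _))
      _ = _ := by ring

lemma growth_lower (y β d k : ℕ) (h : β < y) (hk : k ≤ d) :
    (((y : ℝ) + d) / ((y : ℝ) + d - β)) ^ k * (y.choose β : ℕ) ≤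
      (((y + k).choose β : ℕ) : ℝ) := by
  have hy : (β : ℝ) < (y : ℝ) := by exact_mod_cast h
  have hd : (0 : ℝ) ≤ d := Nat.cast_nonneg d
  have hβ : (0 : ℝ) ≤ β := Nat.cast_nonneg β
  induction k with
  | zero => simp
  | succ k ih =>
    have ih := ih (by omega)
    have e := choose_top_real (y + k) β (by omega)
    push_cast at e
    have hk0 : (0 : ℝ) ≤ k := Nat.cast_nonneg k
    have hkd : (k : ℝ) + 1 ≤ d := by exact_mod_cast hk
    have hpos : (0 : ℝ) < (y : ℝ) + k + 1 - β := by linarith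
    have e2 : (((y + k + 1).choose β : ℕ) : ℝ) =
        ((y + k).choose β : ℕ) * (((y : ℝ) + k + 1) / ((y : ℝ) + k + 1 - β)) := by
      rw [← mul_div_assoc, eq_div_iff hpos.ne']; exact e
    have e3 : ((y : ℝ) + d) / ((y : ℝ) + d - β) ≤
        ((y : ℝ) + k + 1) / ((y : ℝ) + k + 1 - β) := by
      rw [div_le_div_iff₀ (by linarith) hpos]
      nlinarith [mul_nonneg (sub_nonneg.2 hkd) hβ]
    rw [← add_assoc, e2, pow_succ]
    calc _ = ((((y : ℝ) + d) / ((y : ℝ) + d - β)) ^ k * (y.choose β : ℕ)) *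
          (((y : ℝ) + d) / ((y : ℝ) + d - β)) := by ring
      _ ≤ _ := mul_le_mul ih e3 (div_nonneg (by positivity) (by linarith)) (Nat.cast_nonneg _)

set_option maxHeartbeats 800000 in
lemma numeric_contra (a c Z y d : ℕ) (hac : a + 1 ≤ c) 
    (hN2 : (a + c + 2) ^ 2 ≤ 4 * (Z + 1 + d + y) + 8)
    (hXY : y + d ≤ Z) (hy : 2 * (c + 1) ≤ y)
    (E1 : ((Z : ℝ) + 1 + d - a) / ((a : ℝ) + 1) <
      (((Z : ℝ) + 1) / ((Z : ℝ) + 1 - (a + 1))) ^ (d + 1))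
    (E2 : (((y : ℝ) + d) / ((y : ℝ) + d - c)) ^ d < ((y : ℝ) - c) / ((c : ℝ) + 1)) : False := by
  have ha0 : (0 : ℝ) ≤ a := Nat.cast_nonneg a
  have hd0 : (0 : ℝ) ≤ d := Nat.cast_nonneg d
  have rac : (a : ℝ) + 1 ≤ c := by exact_mod_cast hac
  have rN2 : ((a : ℝ) + c + 2) ^ 2 ≤ 4 * (Z + 1 + d + y) + 8 := by exact_mod_cast hN2
  have rXY : (y : ℝ) + d ≤ Z := by exact_mod_cast hXY
  have ry : 2 * ((c : ℝ) + 1) ≤ y := by exact_mod_cast hy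
  generalize hX : (Z : ℝ) + 1 = X at *
  have hXa : 0 < X - (a + 1) := by linarith
  have hYc : 0 < (y : ℝ) + d - c := by linarith
  have hcross : ((a : ℝ) + 1) * (y + d) ≤ c * X := by nlinarith
  have hρσ : X / (X - (a + 1)) ≤ ((y : ℝ) + d) / ((y : ℝ) + d - c) := by
    rw [div_le_div_iff₀ hXa hYc]; nlinarith
  have hρ0 : 0 < X / (X - (a + 1)) := div_pos (by linarith) hXa
  -- combine
  have hmain : X + d * (a + c + 2) < a * (c + 1) := by
    have h1 : (X / (X - (a + 1))) ^ d < ((y : ℝ) - c) / ((c : ℝ) + 1) :=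
      lt_of_le_of_lt (pow_le_pow_left₀ hρ0.le hρσ d) E2
    have h2 : (X + d - a) / ((a : ℝ) + 1) <
        ((y : ℝ) - c) / ((c : ℝ) + 1) * (X / (X - (a + 1))) := by
      refine lt_trans E1 ?_
      rw [pow_succ]
      exact mul_lt_mul_of_pos_right h1 hρ0
    rw [div_mul_div_comm, div_lt_div_iff₀ (by linarith) (mul_pos (by linarith) hXa)] at h2
    -- h2 : (X+d-a) * ((c+1)*(X-(a+1))) < (y-c)*X*(a+1)
    have h3 : ((y : ℝ) - c) * (a + 1) ≤ c * (X - (a + 1)) - (a + 1) * d := by nlinarith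
    have h4 : ((y : ℝ) - c) * X * (a + 1) ≤ X * (c * (X - (a + 1)) - (a + 1) * d) := by
      have := mul_le_mul_of_nonneg_left h3 (show 0 ≤ X by linarith)
      linarith
    have h5 : X * (c * (X - (a + 1)) - (a + 1) * d) ≤
        (c * X - (a + 1) * d) * (X - (a + 1)) := by
      have : 0 ≤ ((a : ℝ) + 1) * d * (a + 1) := by positivity
      nlinarith
    have h6 : (X + d - a) * (c + 1) * (X - (a + 1)) < (c * X - (a + 1) * d) * (X - (a + 1)) := by
      linarith
    have h7 := lt_of_mul_lt_mul_right h6 hXa.le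
    linarith
  have h8X : ((a : ℝ) + c + 2) ^ 2 - 4 ≤ 8 * X := by linarith
  rcases Nat.eq_zero_or_pos d with hd | hd
  · subst hd
    simp only [Nat.cast_zero, add_zero, zero_add, pow_one] at E1
    rw [div_lt_div_iff₀ (by linarith) hXa] at E1
    push_cast at *
    have hX3 : X < 3 * a + 2 := by
      by_contra hcon
      push Not at hcon
      nlinarith
    have ha4 : (3 : ℝ) < a := by linarith
    nlinarith
  · have hd1 : (1 : ℝ) ≤ d := by exact_mod_cast hd
    obtain ⟨M, hM⟩ : ∃ M : ℝ, M = a + c + 1 := ⟨_, rfl⟩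
    have hab : 4 * ((a : ℝ) * (c + 1)) ≤ M ^ 2 - 4 := by
      subst hM; nlinarith
    have hα : 2 * ((a : ℝ) + 1) ≤ M := by linarith
    have hX8 : (M + 1) ^ 2 - 4 ≤ 8 * X := by subst hM; linarith
    have hd8 : 8 * (d : ℝ) < M - 3 := by
      have : (8 * (d : ℝ)) * (M + 1) < (M - 3) * (M + 1) := by
        subst hM; nlinarith
      exact lt_of_mul_lt_mul_right this (by linarith)
    have hM11 : 11 < M := by linarith
    have hM12 : 12 ≤ M := by
      have : 11 < a + c + 1 := by
        have : (11 : ℝ) < ((a + c + 1 : ℕ) : ℝ) := by push_cast; linarith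
        exact_mod_cast this
      have : (12 : ℝ) ≤ ((a + c + 1 : ℕ) : ℝ) := by exact_mod_cast this
      push_cast at this; linarith
    have hr : ((d : ℝ) + 1) * ((a + 1) / (X - (a + 1))) ≤ 1 := by
      rw [← mul_div_assoc, div_le_one hXa]
      have : 16 * (((d : ℝ) + 1) * (a + 1)) ≤ (M + 5) * M := by
        have h8 : 8 * ((d : ℝ) + 1) ≤ M + 5 := by linarith
        have := mul_le_mul h8 hα (by linarith) (by linarith)
        linarith
      have hq : 0 ≤ (M - 12) * (M + 3) := mul_nonneg (by linarith) (by linarith)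
      linarith
    have hρ : X / (X - (a + 1)) = (a + 1) / (X - (a + 1)) + 1 := by
      field_simp; ring
    have hexp : (X / (X - (a + 1))) ^ (d + 1) ≤ Real.exp 1 := by
      calc _ ≤ (Real.exp ((a + 1) / (X - (a + 1)))) ^ (d + 1) := by
            apply pow_le_pow_left₀ hρ0.le
            rw [hρ]; exact Real.add_one_le_exp _
        _ = Real.exp (((d : ℝ) + 1) * ((a + 1) / (X - (a + 1)))) := by
            rw [← Real.exp_nat_mul]; push_cast; rfl
        _ ≤ _ := Real.exp_le_exp.2 hr
    have he := Real.exp_one_lt_d9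
    have hlt : (X + d - a) / ((a : ℝ) + 1) < 2.7183 := by linarith
    rw [div_lt_iff₀ (by linarith)] at hlt
    have hq : 0 ≤ (M - 12) * (M - 11) := mul_nonneg (by linarith) (by linarith)
    linarith

lemma step_lemma (a c x y T : ℕ) (hac : a + 1 ≤ c)
    (hN : 2 * (a + c + 1) ≤ x + y) (hN2 : (a + c + 2) ^ 2 ≤ 4 * (x + y) + 8)
    (h1 : T ≤ x.choose a) (h2 : T ≤ y.choose (c + 1)) :
    ∃ X Y, X + Y = x + y ∧ T ≤ X.choose (a + 1) ∧ T ≤ Y.choose c := by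
  rcases Nat.eq_zero_or_pos T with hT | hT
  · subst hT; exact ⟨x, y, rfl, Nat.zero_le _, Nat.zero_le _⟩
  have hxa : a ≤ x := by
    by_contra hc
    rw [Nat.choose_eq_zero_of_lt (by omega)] at h1; omega
  have hyb : c + 1 ≤ y := by
    by_contra hc
    rw [Nat.choose_eq_zero_of_lt (by omega)] at h2; omega
  by_cases hx : T ≤ x.choose (a + 1)
  swap
  · push Not at hx
    have hx2 : x ≤ 2 * a := by
      by_contra hc
      have := choose_le_aux (a := a) (b := a + 1) (y := x) (by omega) (by omega)
      omega
    have hT2 : T ≤ (2 * a).choose a := h1.trans (Nat.choose_le_choose _ hx2)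
    refine ⟨2 * (a + 1), x + y - 2 * (a + 1), by omega, ?_, ?_⟩
    · refine hT2.trans ((Nat.choose_le_choose a (show 2 * a ≤ 2 * (a + 1) by omega)).trans ?_)
      exact choose_le_aux (by omega) (by omega)
    · refine hT2.trans ((Nat.choose_le_choose a
        (show 2 * a ≤ x + y - 2 * (a + 1) by omega)).trans ?_)
      exact choose_le_aux (by omega) (by omega)
  · classical
    have hex : ∃ X : ℕ, T ≤ X.choose (a + 1) := ⟨x, hx⟩
    have hXle : Nat.find hex ≤ x := Nat.find_min' hex hx
    have hXs := Nat.find_spec hex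
    have hXm : ∀ {k}, k < Nat.find hex → ¬ T ≤ k.choose (a + 1) := fun h => Nat.find_min hex h
    generalize Nat.find hex = X at *
    have hXa : a + 1 ≤ X := by
      by_contra hc
      rw [Nat.choose_eq_zero_of_lt (by omega)] at hXs; omega
    obtain ⟨Z, rfl⟩ : ∃ Z, X = Z + 1 := ⟨X - 1, by omega⟩
    obtain ⟨d, rfl⟩ : ∃ d, x = Z + 1 + d := ⟨x - (Z + 1), by omega⟩
    by_cases hY : T ≤ (y + d).choose c
    · exact ⟨Z + 1, y + d, by omega, hXs, hY⟩
    exfalso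
    push Not at hY
    have hZ : Z.choose (a + 1) < T := by
      have := hXm (k := Z) (by omega); omega
    have hXY : y + d ≤ Z := by
      by_contra hc
      have e1 : (Z + 1).choose (a + 1) ≤ (y + d).choose (a + 1) :=
        Nat.choose_le_choose _ (by omega)
      have e2 := choose_le_aux (a := a + 1) (b := c) (y := y + d) (by omega) (by omega)
      omega
    have hy : 2 * (c + 1) ≤ y := by
      by_contra hc
      have e1 := Nat.choose_succ_right_eq y c
      have e2 : y.choose c * (y - c) ≤ y.choose c * (c + 1) :=
        Nat.mul_le_mul_left _ (by omega)
      have e3 : y.choose (c + 1) ≤ y.choose c := by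
        rw [← e1] at e2
        exact Nat.le_of_mul_le_mul_right e2 (by omega)
      have e4 : y.choose c ≤ (y + d).choose c := Nat.choose_le_choose _ (by omega)
      omega
    have ha0 : (0 : ℝ) ≤ a := Nat.cast_nonneg a
    have hd0 : (0 : ℝ) ≤ d := Nat.cast_nonneg d
    have hc0 : (0 : ℝ) ≤ c := Nat.cast_nonneg c
    have hZa : a + 1 < Z + 1 := by omega
    have rZa : (a : ℝ) + 1 < Z + 1 := by exact_mod_cast hZa
    refine numeric_contra a c Z y d hac hN2 hXY hy ?_ ?_
    · have g := growth_upper Z (a + 1) (d + 1) hZa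
      have e := choose_bot_real (Z + 1 + d) a (by omega)
      rw [show Z + (d + 1) = Z + 1 + d by ring] at g
      push_cast at e g
      have r1 : (Z.choose (a + 1) : ℝ) < T := by exact_mod_cast hZ
      have r2 : (T : ℝ) ≤ ((Z + 1 + d).choose a : ℕ) := by exact_mod_cast h1
      have hpos : (0 : ℝ) < ((Z + 1 + d).choose a : ℕ) := by
        exact_mod_cast Nat.choose_pos hxa
      have hρ : 0 < ((Z : ℝ) + 1) / (Z + 1 - (a + 1)) := div_pos (by linarith) (by linarith)
      have hρp := pow_pos hρ (d + 1)
      rw [div_lt_iff₀ (by linarith)]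
      have k1 : (((Z + 1 + d).choose (a + 1) : ℕ) : ℝ) <
          (((Z : ℝ) + 1) / (Z + 1 - (a + 1))) ^ (d + 1) * ((Z + 1 + d).choose a : ℕ) :=
        lt_of_le_of_lt g (mul_lt_mul_of_pos_left (by linarith) hρp)
      have k2 := mul_lt_mul_of_pos_right k1 (show (0 : ℝ) < a + 1 by linarith)
      rw [e] at k2
      refine lt_of_mul_lt_mul_left ?_ hpos.le
      calc _ < _ := k2
        _ = _ := by ring
    · have g := growth_lower y c d d (by omega) le_rfl
      have e := choose_bot_real y c (by omega)
      have r1 : ((y + d).choose c : ℝ) < T := by exact_mod_cast hY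
      have r2 : (T : ℝ) ≤ (y.choose (c + 1) : ℕ) := by exact_mod_cast h2
      have hpos : (0 : ℝ) < (y.choose c : ℕ) := by
        exact_mod_cast Nat.choose_pos (show c ≤ y by omega)
      rw [lt_div_iff₀ (by linarith)]
      have k1 : (((y : ℝ) + d) / ((y : ℝ) + d - c)) ^ d * (y.choose c : ℕ) <
          (y.choose (c + 1) : ℕ) := by linarith
      have k2 := mul_lt_mul_of_pos_right k1 (show (0 : ℝ) < c + 1 by linarith)
      rw [e] at k2
      refine lt_of_mul_lt_mul_left ?_ hpos.le
      calc _ = _ := by ring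
        _ < _ := k2

/-- iterate the step up to `a + j`. -/
lemma iter_lemma (j : ℕ) : ∀ (a b x y T : ℕ), 2 * (a + j) ≤ a + b →
    2 * (a + b) ≤ x + y → (a + b + 1) ^ 2 ≤ 4 * (x + y) + 8 →
    T ≤ x.choose a → T ≤ y.choose b →
    ∃ X Y, X + Y = x + y ∧ T ≤ X.choose (a + j) ∧ T ≤ Y.choose (b - j) := by
  induction j with
  | zero => intro a b x y T _ _ _ h1 h2; exact ⟨x, y, rfl, h1, h2⟩
  | succ j ih =>
    intro a b x y T hj hN hN2 h1 h2
    obtain ⟨c, rfl⟩ : ∃ c, b = c + 1 := ⟨b - 1, by omega⟩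
    obtain ⟨X, Y, e, k1, k2⟩ := step_lemma a c x y T (by omega) (by omega)
      (by rw [← add_assoc] at hN2; exact hN2) h1 h2
    obtain ⟨X', Y', e', k1', k2'⟩ := ih (a + 1) c X Y T (by omega) (by omega)
      (by rw [e, show a + 1 + c + 1 = a + (c + 1) + 1 by ring]; exact hN2) k1 k2
    refine ⟨X', Y', by omega, ?_, ?_⟩
    · rwa [show a + (j + 1) = a + 1 + j by ring]
    · rwa [show c + 1 - (j + 1) = c - j by omega]

/-- Theorem 3.5: for integers `m ≥ 3` and `n` with `n ≥ 2m - 1` and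
`n ≥ m²/4 - 1`, letting `p* = ⌊(m-1)/2⌋` and `k*` the largest integer
`k ∈ [p*, n - m + p*]` with `C(k, p*) ≤ C(n-k-1, m-p*-1)`, the largest rank computable
by the algorithm,
`r_max = max_{1 ≤ p ≤ m-2} max_{p+1 ≤ k ≤ n-m+p-1} min (C(k,p)) (C(n-k-1, m-p-1))`,
satisfies `r_max = max (C(k*, p*)) (C(n-2-k*, m-1-p*))`. -/
theorem largest_rank_formula
    (m n : ℕ) (hm : 3 ≤ m) (hn1 : 2 * m - 1 ≤ n)
    (hn2 : (m : ℝ) ^ 2 / 4 - 1 ≤ (n : ℝ))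
    (pstar kstar : ℕ) (hpstar : pstar = (m - 1) / 2)
    (hk0 : pstar ≤ kstar) (hk1 : kstar ≤ n - m + pstar)
    (hk2 : Nat.choose kstar pstar ≤ Nat.choose (n - kstar - 1) (m - pstar - 1))
    (hk3 : ∀ k : ℕ, pstar ≤ k → k ≤ n - m + pstar →
      Nat.choose k pstar ≤ Nat.choose (n - k - 1) (m - pstar - 1) → k ≤ kstar)
    (rmax : ℕ)
    (hrmax : rmax =
      (Finset.Icc 1 (m - 2)).sup fun p =>
        (Finset.Icc (p + 1) (n - m + p - 1)).sup fun k =>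
          min (Nat.choose k p) (Nat.choose (n - k - 1) (m - p - 1))) :
    rmax = max (Nat.choose kstar pstar) (Nat.choose (n - 2 - kstar) (m - 1 - pstar)) := by
  have hsq : m ^ 2 ≤ 4 * n + 4 := by
    have : (m : ℝ) ^ 2 ≤ 4 * n + 4 := by linarith
    exact_mod_cast this
  obtain ⟨M, rfl⟩ : ∃ M, m = M + 1 := ⟨m - 1, by omega⟩
  obtain ⟨N, rfl⟩ : ∃ N, n = N + 1 := ⟨n - 1, by omega⟩
  rw [show N + 1 - 2 - kstar = N - kstar - 1 by omega,
    show M + 1 - 1 - pstar = M - pstar by omega]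
  rw [show N + 1 - kstar - 1 = N - kstar by omega,
    show M + 1 - pstar - 1 = M - pstar by omega] at hk2
  have hp1 : 1 ≤ pstar := by omega
  have hp2 : 2 * pstar ≤ M := by omega
  have hp3 : M ≤ 2 * pstar + 1 := by omega
  have hk3' : ∀ k : ℕ, kstar < k → k ≤ N - M + pstar →
      (N - k).choose (M - pstar) < k.choose pstar := by
    intro k h1 h2
    by_contra hc
    push Not at hc
    have := hk3 k (by omega) (by omega)
      (by rwa [show N + 1 - k - 1 = N - k by omega, show M + 1 - pstar - 1 = M - pstar by omega])
    omega
  have hlow : pstar + 1 ≤ kstar := by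
    by_contra hc
    have h := hk3' (pstar + 1) (by omega) (by omega)
    rw [Nat.choose_succ_self_right] at h
    have h2 : (M - pstar + 1).choose (M - pstar) ≤ (N - (pstar + 1)).choose (M - pstar) :=
      Nat.choose_le_choose _ (by omega)
    rw [Nat.choose_succ_self_right] at h2
    omega
  have hbig : ∀ k, pstar + 1 ≤ k → 1 < k.choose pstar := by
    intro k h
    have := Nat.choose_le_choose pstar h
    rw [Nat.choose_succ_self_right] at this
    omega
  have hup : kstar + 1 ≤ N - M + pstar := by
    by_contra hc
    rw [show N - kstar = M - pstar by omega, Nat.choose_self] at hk2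
    have := hbig kstar hlow
    omega
  -- upper bound for `p ≤ pstar`
  have key : ∀ p x y T : ℕ, p ≤ pstar → x + y = N → T ≤ x.choose p → T ≤ y.choose (M - p) →
      T ≤ max (kstar.choose pstar) ((N - kstar - 1).choose (M - pstar)) := by
    intro p x y T hp hxy h1 h2
    obtain ⟨X, Y, e, k1, k2⟩ := iter_lemma (pstar - p) p (M - p) x y T (by omega) (by omega)
      (by rw [show p + (M - p) = M by omega, hxy]; omega) h1 h2
    rw [show p + (pstar - p) = pstar by omega] at k1
    rw [show M - p - (pstar - p) = M - pstar by omega] at k2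
    rcases Nat.lt_or_ge kstar X with h | h
    · exact le_max_of_le_right (k2.trans (Nat.choose_le_choose _ (by omega)))
    · exact le_max_of_le_left (k1.trans (Nat.choose_le_choose _ h))
  rw [hrmax]
  apply le_antisymm
  · refine Finset.sup_le fun p hp => Finset.sup_le fun k hk => ?_
    rw [Finset.mem_Icc] at hp hk
    rw [show N + 1 - k - 1 = N - k by omega, show M + 1 - p - 1 = M - p by omega]
    rcases Nat.lt_or_ge pstar p with h | h
    · refine key (M - p) (N - k) k _ (by omega) (by omega) (min_le_right _ _) ?_
      rw [show M - (M - p) = p by omega]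
      exact min_le_left _ _
    · exact key p k (N - k) _ h (by omega) (min_le_left _ _) (min_le_right _ _)
  · have att : ∀ k, pstar + 1 ≤ k → k + 1 ≤ N - M + pstar →
        min (k.choose pstar) ((N - k).choose (M - pstar)) ≤
        (Finset.Icc 1 (M + 1 - 2)).sup fun p =>
        (Finset.Icc (p + 1) (N + 1 - (M + 1) + p - 1)).sup fun k =>
          min (Nat.choose k p) (Nat.choose (N + 1 - k - 1) (M + 1 - p - 1)) := by
      intro k h1 h2
      refine le_trans ?_ (Finset.le_sup (b := pstar) (Finset.mem_Icc.2 ⟨by omega, by omega⟩))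
      refine le_trans ?_ (Finset.le_sup (b := k) (Finset.mem_Icc.2 ⟨by omega, by omega⟩))
      rw [show N + 1 - k - 1 = N - k by omega, show M + 1 - pstar - 1 = M - pstar by omega]
    rcases le_or_gt ((N - kstar - 1).choose (M - pstar)) (kstar.choose pstar) with h | h
    · rw [max_eq_left h]
      have := att kstar hlow hup
      rwa [min_eq_left hk2] at this
    · rw [max_eq_right h.le]
      have hup2 : kstar + 2 ≤ N - M + pstar := by
        by_contra hc
        rw [show N - kstar - 1 = M - pstar by omega, Nat.choose_self] at h
        have := hbig kstar hlow
        omega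
      have h3 := hk3' (kstar + 1) (by omega) (by omega)
      have := att (kstar + 1) (by omega) (by omega)
      rw [min_eq_right h3.le] at this
      rwa [show N - kstar - 1 = N - (kstar + 1) by omega]
end

section
/- Let m ≥ 3 be an odd integer and n an integer with n ≥ 2m−1 and n ≥ m²/4 − 1. Then max over integers p ∈ [1, m−2] and k ∈ [p, n−m+p] of min(C(k, p), C(n−k−1, m−p−1)) = C(⌊(n−1)/2⌋, (m−1)/2). -/
lemma lr_up (k p : ℕ) (h : p ≤ k) :
    (Nat.choose (k+1) p : ℝ) * ((k:ℝ) + 1 - p) = ((k:ℝ)+1) * Nat.choose k p := by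
  have := Nat.choose_mul_succ_eq k p
  have h2 : ((k + 1 - p : ℕ) : ℝ) = (k:ℝ) + 1 - p := by
    rw [Nat.cast_sub (by omega)]; push_cast; ring
  rw [← h2]
  have h3 : ((Nat.choose k p * (k+1) : ℕ) : ℝ) = ((Nat.choose (k+1) p * (k + 1 - p) : ℕ) : ℝ) := by
    rw [this]
  push_cast at h3 ⊢
  linarith

lemma lr_right (k p : ℕ) (h : p ≤ k) :
    (Nat.choose k (p+1) : ℝ) * ((p:ℝ) + 1) = ((k:ℝ) - p) * Nat.choose k p := by
  have := Nat.choose_succ_right_eq k p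
  rw [← Nat.cast_sub h]
  have h3 : ((Nat.choose k (p+1) * (p+1) : ℕ) : ℝ) = ((Nat.choose k p * (k - p) : ℕ) : ℝ) := by
    rw [this]
  push_cast at h3 ⊢
  linarith

lemma lr_shift (k l p q : ℕ) (hpq : p ≤ q) (hl : q ≤ l) (hk : l ≤ k) :
    (Nat.choose (k+1) p : ℝ) * Nat.choose l q ≤ Nat.choose k p * Nat.choose (l+1) q := by
  have h1 := lr_up k p (by omega)
  have h2 := lr_up l q hl
  have a1 : (p:ℝ) ≤ q := by exact_mod_cast hpq
  have a2 : (q:ℝ) ≤ l := by exact_mod_cast hl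
  have a3 : (l:ℝ) ≤ k := by exact_mod_cast hk
  have a0 : (0:ℝ) ≤ p := by positivity
  have e1 : (Nat.choose (k+1) p : ℝ) = ((k:ℝ)+1) * Nat.choose k p / ((k:ℝ) + 1 - p) := by
    rw [eq_div_iff (by linarith)]; exact h1
  have e2 : (Nat.choose (l+1) q : ℝ) = ((l:ℝ)+1) * Nat.choose l q / ((l:ℝ) + 1 - q) := by
    rw [eq_div_iff (by linarith)]; exact h2
  rw [e1, e2]
  have e3 : ((k:ℝ)+1) / ((k:ℝ) + 1 - p) ≤ ((l:ℝ)+1) / ((l:ℝ) + 1 - q) := by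
    rw [div_le_div_iff₀ (by linarith) (by linarith)]
    nlinarith
  have := mul_le_mul_of_nonneg_left e3
    (show (0:ℝ) ≤ (Nat.choose k p : ℝ) * Nat.choose l q by positivity)
  calc _ = (Nat.choose k p : ℝ) * Nat.choose l q * (((k:ℝ)+1) / ((k:ℝ) + 1 - p)) := by ring
    _ ≤ _ := this
    _ = _ := by ring

lemma lr_shift_iter (p q k : ℕ) (hpq : p ≤ q) (s : ℕ) : ∀ l, q ≤ l → l + s ≤ k →
    (Nat.choose (k+s) p : ℝ) * Nat.choose l q ≤ Nat.choose k p * Nat.choose (l+s) q := by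
  induction s with
  | zero => intro l _ _; simp
  | succ s ih =>
    intro l hl hk
    have h1 := lr_shift (k+s) l p q hpq hl (by omega)
    have h2 := ih (l+1) (by omega) (by omega)
    have e : l + 1 + s = l + (s+1) := by ring
    rw [e] at h2
    exact h1.trans h2

/-- shift with gain, `q = p + 2`, `r = p + 1`. -/
lemma lr_gain (p h i l : ℕ) (hl : p + 2 ≤ l) (hi : l + i + 1 = h) :
    (1 + 2 / ((h:ℝ) - p - 1)) * ((Nat.choose (h+i+1) p : ℝ) * Nat.choose l (p+2))
      ≤ Nat.choose (h+i) p * Nat.choose (l+1) (p+2) := by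
  have h1 := lr_up (h+i) p (by omega)
  have h2 := lr_up l (p+2) hl
  have a2 : (p:ℝ) + 2 ≤ l := by exact_mod_cast hl
  have a3 : (l:ℝ) + i + 1 = h := by exact_mod_cast hi
  have a0 : (0:ℝ) ≤ p := by positivity
  have ai : (0:ℝ) ≤ i := by positivity
  push_cast at h1 h2
  have e1 : (Nat.choose (h+i+1) p : ℝ) = ((h:ℝ)+i+1) * Nat.choose (h+i) p / ((h:ℝ)+ i + 1 - p) := by
    rw [eq_div_iff (by linarith)]; exact h1
  have e2 : (Nat.choose (l+1) (p+2) : ℝ) =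
      ((l:ℝ)+1) * Nat.choose l (p+2) / ((l:ℝ) + 1 - (p+2)) := by
    rw [eq_div_iff (by linarith)]; exact h2
  rw [e1, e2]
  have e3 : (1 + 2 / ((h:ℝ) - p - 1)) * (((h:ℝ)+i+1) / ((h:ℝ) + i + 1 - p))
      ≤ ((l:ℝ)+1) / ((l:ℝ) + 1 - (p+2)) := by
    have e4 : (1 + 2 / ((h:ℝ) - p - 1)) = ((h:ℝ) - p + 1) / ((h:ℝ) - p - 1) := by
      have : (h:ℝ) - p - 1 ≠ 0 := by linarith
      field_simp; ring
    rw [e4, div_mul_div_comm, div_le_div_iff₀ (by apply mul_pos <;> linarith) (by linarith)]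
    obtain ⟨t, ht, hte⟩ : ∃ t : ℝ, 0 ≤ t ∧ (l:ℝ) = p + 2 + t := ⟨l - p - 2, by linarith, by ring⟩
    rw [← a3, hte]
    ring_nf
    have : 0 ≤ t * i := by positivity
    nlinarith [mul_nonneg a0 ai, mul_nonneg a0 ht, mul_nonneg (mul_nonneg a0 ai) ht,
      mul_nonneg (mul_nonneg a0 ai) ai, mul_nonneg ai ai, mul_nonneg (mul_nonneg a0 a0) ai,
      mul_nonneg (mul_nonneg ai ai) ai, mul_nonneg (mul_nonneg ai ai) ht,
      mul_nonneg (mul_nonneg ht ht) ai, mul_nonneg ht ht]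
  have := mul_le_mul_of_nonneg_left e3
    (show (0:ℝ) ≤ (Nat.choose (h+i) p : ℝ) * Nat.choose l (p+2) by positivity)
  calc _ = (Nat.choose (h+i) p : ℝ) * Nat.choose l (p+2) *
        ((1 + 2 / ((h:ℝ) - p - 1)) * (((h:ℝ)+i+1) / ((h:ℝ) + i + 1 - p))) := by ring
    _ ≤ _ := this
    _ = _ := by ring

lemma lr_gain_iter (p h : ℕ) (hh : p + 2 ≤ h) (s : ℕ) : ∀ l, p + 2 ≤ l → l + s = h →
    (1 + 2 / ((h:ℝ) - p - 1))^s * ((Nat.choose (h+s) p : ℝ) * Nat.choose l (p+2))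
      ≤ Nat.choose h p * Nat.choose h (p+2) := by
  have a1 : (p:ℝ) + 2 ≤ h := by exact_mod_cast hh
  induction s with
  | zero => intro l _ h2; simp at h2; simp [h2]
  | succ s ih =>
    intro l hl hk
    have h1 := lr_gain p h s l hl (by omega)
    have h2 := ih (l+1) (by omega) (by omega)
    have h0 : (0:ℝ) ≤ (1 + 2 / ((h:ℝ) - p - 1))^s := by
      apply pow_nonneg
      have : (0:ℝ) ≤ 2 / ((h:ℝ) - p - 1) := div_nonneg (by norm_num) (by linarith)
      linarith
    have h3 := mul_le_mul_of_nonneg_left h1 h0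
    rw [pow_succ, mul_assoc]
    exact h3.trans h2

lemma lr_mono_half (h p j : ℕ) (hj : 2 * (p + j) ≤ h) : Nat.choose h p ≤ Nat.choose h (p+j) := by
  induction j with
  | zero => simp
  | succ j ih =>
    refine (ih (by omega)).trans ?_
    exact Nat.choose_le_succ_of_lt_half_left (by omega)

/-- Exact step. -/
lemma lr_step (h a b : ℕ) (ha : a + 1 ≤ h) (hb : b + 1 ≤ h) :
    (Nat.choose h a : ℝ) * Nat.choose h (b+1) * (((h:ℝ) - a) * (b+1)) =
      Nat.choose h (a+1) * Nat.choose h b * (((h:ℝ) - b) * (a+1)) := by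
  have h1 := lr_right h a (by omega)
  have h2 := lr_right h b (by omega)
  linear_combination ((h:ℝ) - a) * (Nat.choose h a : ℝ) * h2 - ((h:ℝ) - b) * (Nat.choose h b : ℝ) * h1

/-- log-concavity -/
lemma lr_logc (h a b : ℕ) (hab : a ≤ b) (hb : b + 1 ≤ h) :
    (Nat.choose h a : ℝ) * Nat.choose h (b+1) ≤ Nat.choose h (a+1) * Nat.choose h b := by
  have h1 := lr_step h a b (by omega) hb
  have a1 : (a:ℝ) ≤ b := by exact_mod_cast hab
  have a2 : (b:ℝ) + 1 ≤ h := by exact_mod_cast hb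
  have a0 : (0:ℝ) ≤ a := by positivity
  have hp : (0:ℝ) < ((h:ℝ) - a) * (b+1) := mul_pos (by linarith) (by linarith)
  have hle : ((h:ℝ) - b) * (a+1) ≤ ((h:ℝ) - a) * (b+1) := by nlinarith
  have := mul_le_mul_of_nonneg_left hle
    (show (0:ℝ) ≤ (Nat.choose h (a+1) : ℝ) * Nat.choose h b by positivity)
  exact le_of_mul_le_mul_right (h1.trans_le this) hp

lemma lr_one (h p : ℕ) (hh : p + 2 ≤ h) :
    (Nat.choose h p : ℝ) * Nat.choose h (p+2) * ((p:ℝ)+2) ≤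
      (p+1) * (Nat.choose h (p+1) : ℝ)^2 := by
  have h1 := lr_step h p (p+1) (by omega) (by omega)
  have a1 : (p:ℝ) + 2 ≤ h := by exact_mod_cast hh
  have a0 : (0:ℝ) ≤ p := by positivity
  push_cast at h1
  have h2 : (0:ℝ) ≤ (Nat.choose h (p+1) : ℝ)^2 * (p+1) := by positivity
  have : (Nat.choose h p : ℝ) * Nat.choose h (p+2) * ((p:ℝ)+2) * ((h:ℝ)-p) ≤
      (p+1) * (Nat.choose h (p+1) : ℝ)^2 * ((h:ℝ)-p) := by
    have e : p + 1 + 1 = p + 2 := rfl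
    rw [e] at h1
    nlinarith
  exact le_of_mul_le_mul_right this (by linarith)

lemma lr_two (h p : ℕ) (hh : p + 4 ≤ h) :
    (Nat.choose h p : ℝ) * Nat.choose h (p+4) * (((p:ℝ)+3) * (p+4)) ≤
      (p+1) * (p+2) * (Nat.choose h (p+2) : ℝ)^2 := by
  have h1 := lr_step h p (p+3) (by omega) (by omega)
  have h2 := lr_one h (p+1) (by omega)
  have a1 : (p:ℝ) + 4 ≤ h := by exact_mod_cast hh
  have a0 : (0:ℝ) ≤ p := by positivity
  push_cast at h1 h2
  have e : p + 3 + 1 = p + 4 := rfl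
  have e2 : p + 1 + 2 = p + 3 := rfl
  have e3 : p + 1 + 1 = p + 2 := rfl
  rw [e] at h1
  rw [e2, e3] at h2
  have h3 : (Nat.choose h p : ℝ) * Nat.choose h (p+4) * ((p:ℝ)+4) ≤
      (p+1) * ((Nat.choose h (p+1) : ℝ) * Nat.choose h (p+3)) := by
    have h0 : (0:ℝ) ≤ (Nat.choose h (p+1) : ℝ) * Nat.choose h (p+3) * (p+1) := by positivity
    have : (Nat.choose h p : ℝ) * Nat.choose h (p+4) * ((p:ℝ)+4) * ((h:ℝ)-p) ≤
      (p+1) * ((Nat.choose h (p+1) : ℝ) * Nat.choose h (p+3)) * ((h:ℝ)-p) := by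
      nlinarith
    exact le_of_mul_le_mul_right this (by linarith)
  have h4 := mul_le_mul_of_nonneg_right h3 (show (0:ℝ) ≤ (p:ℝ)+3 by linarith)
  have h5 := mul_le_mul_of_nonneg_left h2 (show (0:ℝ) ≤ (p:ℝ)+1 by linarith)
  nlinarith

lemma lr_many (h j : ℕ) : ∀ p, p + 4 + 2 * j ≤ h →
    (Nat.choose h p : ℝ) * Nat.choose h (p+4+2*j) ≤
      Nat.choose h (p+j) * Nat.choose h (p+j+4) := by
  induction j with
  | zero => intro p _; simp
  | succ j ih =>
    intro p hp
    have h1 := lr_logc h p (p+1+4+2*j) (by omega) (by omega)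
    have h2 := ih (p+1) (by omega)
    have e1 : p+1+4+2*j+1 = p+4+2*(j+1) := by ring
    have e2 : p+1+j = p+(j+1) := by ring
    rw [e1] at h1
    rw [e2] at h2
    exact h1.trans h2

lemma lr_min (a b M : ℕ) (h : (a:ℝ) * b ≤ (M:ℝ)^2) : min a b ≤ M := by
  by_contra hc
  have h1 : M < a ∧ M < b := by
    simpa using hc
  have h2 : M * M < a * b := Nat.mul_lt_mul'' h1.1 h1.2
  have h3 : a * b ≤ M^2 := by exact_mod_cast h
  rw [pow_two] at h3
  omega

/-- case `j ≥ 2` -/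
lemma lr_case2 (p j h s l : ℕ) (h2 : 2 * (p + j + 2) ≤ h)
    (h3 : (p+j+2) * (p+j+3) ≤ 2 * h + 2) (hl : p + 4 + 2 * j ≤ l) (hs : l + s = h) :
    min (Nat.choose (h+s+1) p) (Nat.choose l (p+4+2*j)) ≤ Nat.choose h (p+j+2) := by
  apply lr_min
  have b1 := lr_shift_iter p (p+4+2*j) h (by omega) s l hl (by omega)
  rw [hs] at b1
  have b2 := lr_many h j p (by omega)
  have b3 := lr_two h (p+j) (by omega)
  have b4 := lr_up (h+s) p (by omega)
  have c : (Nat.choose (h+s) p : ℝ) * Nat.choose l (p+4+2*j) ≤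
    Nat.choose h (p+j) * Nat.choose h (p+j+4) := b1.trans b2
  set A : ℝ := (Nat.choose (h+s) p : ℝ)
  set B : ℝ := (Nat.choose l (p+4+2*j) : ℝ) with hB
  set A' : ℝ := (Nat.choose (h+s+1) p : ℝ)
  set M : ℝ := (Nat.choose h (p+j+2) : ℝ)
  have hA : 0 ≤ A * B := by positivity
  have h2' : 2 * ((p:ℝ) + j + 2) ≤ h := by exact_mod_cast h2
  have h3' : ((p:ℝ) + j + 2) * (p + j + 3) ≤ 2 * h + 2 := by exact_mod_cast h3
  push_cast at b3 b4
  have p0 : (0:ℝ) ≤ p := by positivity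
  have j0 : (0:ℝ) ≤ j := by positivity
  have s0 : (0:ℝ) ≤ s := by positivity
  set x : ℝ := (p:ℝ) + j with hx
  have x0 : 0 ≤ x := by positivity
  have px : (p:ℝ) ≤ x := by linarith
  have c2 : A * B * ((x+3)*(x+4)) ≤ (x+1)*(x+2) * M^2 :=
    (mul_le_mul_of_nonneg_right c (by positivity)).trans b3
  have c3 : ((h:ℝ)+s+1) * ((x+1)*(x+2)) ≤ ((x+3)*(x+4)) * ((h:ℝ)+s+1-p) := by
    have : ((x+3)*(x+4)) * ((h:ℝ)+s+1-x) ≤ ((x+3)*(x+4)) * ((h:ℝ)+s+1-p) :=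
      mul_le_mul_of_nonneg_left (by linarith) (by positivity)
    refine le_trans ?_ this
    have s1 : 0 ≤ x * s := by positivity
    nlinarith [mul_nonneg x0 x0, mul_le_mul_of_nonneg_left h3' x0]
  have hd : 0 < (h:ℝ)+s+1-p := by linarith
  have hq : 0 < (x+3)*(x+4) := by positivity
  have hM : 0 ≤ M^2 := by positivity
  have key : A' * B * (((h:ℝ)+s+1-p) * ((x+3)*(x+4))) ≤ M^2 * (((h:ℝ)+s+1-p) * ((x+3)*(x+4))) := by
    calc A' * B * (((h:ℝ)+s+1-p) * ((x+3)*(x+4)))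
        = ((h:ℝ)+s+1) * (A * B * ((x+3)*(x+4))) := by
          linear_combination B * ((x+3)*(x+4)) * b4
      _ ≤ ((h:ℝ)+s+1) * ((x+1)*(x+2) * M^2) := mul_le_mul_of_nonneg_left c2 (by positivity)
      _ = M^2 * (((h:ℝ)+s+1) * ((x+1)*(x+2))) := by ring
      _ ≤ M^2 * (((x+3)*(x+4)) * ((h:ℝ)+s+1-p)) := mul_le_mul_of_nonneg_left c3 hM
      _ = _ := by ring
  exact le_of_mul_le_mul_right key (by positivity)

/-- case `j = 1`, large shift -/
lemma lr_case1_large (p h s l : ℕ) (h2 : 2 * (p + 1) ≤ h) (hp : 1 ≤ p)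
    (h3 : (p+1) * (p+2) ≤ 2 * h + 2) (hl : p + 2 ≤ l) (hs : l + s = h) (h4 : p + 1 ≤ 4 * s) :
    min (Nat.choose (h+s+1) p) (Nat.choose l (p+2)) ≤ Nat.choose h (p+1) := by
  apply lr_min
  have b1 := lr_gain_iter p h (by omega) s l hl hs
  have b3 := lr_one h p (by omega)
  have b4 := lr_up (h+s) p (by omega)
  have h1' : (p:ℝ) + 2 ≤ h := by exact_mod_cast (show p + 2 ≤ h by omega)
  have h3' : ((p:ℝ) + 1) * (p + 2) ≤ 2 * h + 2 := by exact_mod_cast h3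
  have h4' : (p:ℝ) + 1 ≤ 4 * s := by exact_mod_cast h4
  have p0 : (1:ℝ) ≤ p := by exact_mod_cast hp
  have hg : (0:ℝ) < (h:ℝ) - p - 1 := by linarith
  have bern : 1 + (s:ℝ) * (2 / ((h:ℝ) - p - 1)) ≤ (1 + 2 / ((h:ℝ) - p - 1))^s :=
    one_add_mul_le_pow (by have : 0 ≤ 2 / ((h:ℝ) - p - 1) := by positivity
                           linarith) s
  set A : ℝ := (Nat.choose (h+s) p : ℝ)
  set B : ℝ := (Nat.choose l (p+2) : ℝ) with hB
  set A' : ℝ := (Nat.choose (h+s+1) p : ℝ)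
  set M : ℝ := (Nat.choose h (p+1) : ℝ)
  push_cast at b4
  have hA : 0 ≤ A * B := by positivity
  set G : ℝ := 1 + (s:ℝ) * (2 / ((h:ℝ) - p - 1)) with hG
  have G1 : G * (A * B) ≤ Nat.choose h p * Nat.choose h (p+2) :=
    (mul_le_mul_of_nonneg_right bern hA).trans b1
  have Gpos : 0 < G := by positivity
  have c2 : G * (A * B) * ((p:ℝ)+2) ≤ (p+1) * M^2 :=
    (mul_le_mul_of_nonneg_right G1 (by positivity)).trans b3
  have hd : 0 < (h:ℝ)+s+1-p := by linarith
  have c3 : ((h:ℝ)+s+1) * (p+1) ≤ G * ((p:ℝ)+2) * ((h:ℝ)+s+1-p) := by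
    have e : G = ((h:ℝ) - p - 1 + 2 * s) / ((h:ℝ) - p - 1) := by
      rw [hG]; field_simp
    rw [e, div_mul_eq_mul_div, div_mul_eq_mul_div, le_div_iff₀ hg]
    obtain ⟨t, ht, hte⟩ : ∃ t : ℝ, 0 ≤ t ∧ (s:ℝ) = (p+1)/4 + t :=
      ⟨s - (p+1)/4, by linarith, by ring⟩
    obtain ⟨u, hu, hue⟩ : ∃ u : ℝ, 0 < u ∧ (h:ℝ) = p + 1 + u := ⟨h - p - 1, hg, by ring⟩
    obtain ⟨y, hy, hye⟩ : ∃ y : ℝ, 0 ≤ y ∧ (p:ℝ) = 1 + y := ⟨p - 1, by linarith, by ring⟩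
    have hu2 : y * (y + 3) ≤ 2 * u := by rw [hue, hye] at h3'; nlinarith
    rw [hte, hue, hye]
    have := mul_nonneg hu.le (sub_nonneg.2 hu2)
    have := mul_nonneg ht (sub_nonneg.2 hu2)
    have := mul_nonneg ht hu.le
    have := mul_nonneg hy hu.le
    have := mul_nonneg ht hy
    have := mul_nonneg (mul_nonneg hy hu.le) hy
    have := mul_nonneg (mul_nonneg hy hu.le) ht
    have := mul_nonneg (mul_nonneg hy ht) hy
    have := mul_nonneg (mul_nonneg hy ht) ht
    have := mul_nonneg (mul_nonneg hy hy) hy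
    have := mul_nonneg hy hy
    have := mul_nonneg ht ht
    nlinarith
  have hM : 0 ≤ M^2 := by positivity
  have key : A' * B * (((h:ℝ)+s+1-p) * (G*(p+2))) ≤ M^2 * (((h:ℝ)+s+1-p) * (G*(p+2))) := by
    calc A' * B * (((h:ℝ)+s+1-p) * (G*(p+2)))
        = ((h:ℝ)+s+1) * (G * (A * B) * (p+2)) := by
          linear_combination B * (G*(p+2)) * b4
      _ ≤ ((h:ℝ)+s+1) * ((p+1) * M^2) := mul_le_mul_of_nonneg_left c2 (by positivity)
      _ = M^2 * (((h:ℝ)+s+1) * (p+1)) := by ring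
      _ ≤ M^2 * (G * ((p:ℝ)+2) * ((h:ℝ)+s+1-p)) := mul_le_mul_of_nonneg_left c3 hM
      _ = _ := by ring
  exact le_of_mul_le_mul_right key (by positivity)

/-- Bernoulli-type bound -/
lemma lr_bern (p h : ℕ) (hp : p ≤ h) (t : ℕ) :
    (Nat.choose (h+t) p : ℝ) * ((h:ℝ) + 1 - t * p) ≤ (h+1) * Nat.choose h p := by
  induction t with
  | zero => simp; linarith
  | succ t ih =>
    by_cases hneg : (h:ℝ) + 1 - (t+1:ℕ) * p ≤ 0
    · have : (Nat.choose (h+(t+1)) p : ℝ) * ((h:ℝ) + 1 - (t+1:ℕ) * p) ≤ 0 :=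
        mul_nonpos_of_nonneg_of_nonpos (by positivity) hneg
      exact this.trans (by positivity)
    · refine le_trans ?_ ih
      have b := lr_up (h+t) p (by omega)
      push_cast at b hneg ⊢
      have hp' : (p:ℝ) ≤ h := by exact_mod_cast hp
      have t0 : (0:ℝ) ≤ t := by positivity
      have p0 : (0:ℝ) ≤ p := by positivity
      have hd : 0 < (h:ℝ)+t+1-p := by linarith
      have e : ((h:ℝ)+t+1) * ((h:ℝ) + 1 - (t+1) * p) ≤ ((h:ℝ) + 1 - t * p) * ((h:ℝ)+t+1-p) := by
        nlinarith [mul_nonneg t0 p0, mul_nonneg (mul_nonneg t0 p0) p0]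
      have e2 := mul_le_mul_of_nonneg_left e
        (show (0:ℝ) ≤ (Nat.choose (h+t) p : ℝ) by positivity)
      rw [← add_assoc]
      refine le_of_mul_le_mul_right (a := (h:ℝ)+t+1-p) ?_ hd
      nlinarith

/-- case `j = 1`, small shift -/
lemma lr_case1_small (p h s : ℕ) (h2 : 2 * (p + 1) ≤ h) (hp : 1 ≤ p)
    (h3 : (p+1) * (p+2) ≤ 2 * h + 2) (h4 : 4 * s ≤ p)
    (e1 : ¬ (p = 2 ∧ h = 6)) (e2 : ¬ (p = 4 ∧ h = 14)) :
    Nat.choose (h+s+1) p ≤ Nat.choose h (p+1) := by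
  have b := lr_bern p h (by omega) (s+1)
  have c := lr_right h p (by omega)
  -- suffices (p+1)(h+1) ≤ (h-p)(h+1-(s+1)p)
  have hnat : (p+1)*(h+1) + (h-p)*((s+1)*p) ≤ (h-p)*(h+1) := by
    obtain ⟨d, rfl⟩ : ∃ d, h = p + d := ⟨h - p, by omega⟩
    rw [Nat.add_sub_cancel_left]
    by_cases hp5 : 5 ≤ p
    · have : 4 * ((s+1)*p) ≤ (p+4)*p := by nlinarith
      have h5 : d * (4 * ((s+1)*p)) ≤ d * ((p+4)*p) := Nat.mul_le_mul_left _ this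
      obtain ⟨y, rfl⟩ : ∃ y, p = y + 5 := ⟨p - 5, by omega⟩
      obtain ⟨f, hf⟩ : ∃ f, 2 * d = f + (y+5)*(y+6) := by
        refine ⟨2 * d - (y+5)*(y+6), ?_⟩
        have : (y+5)*(y+6) ≤ 2 * d := by nlinarith
        omega
      have y0 : 0 ≤ y := Nat.zero_le _
      nlinarith [Nat.zero_le (f*f), Nat.zero_le (f*y), Nat.zero_le (f*y*y), Nat.zero_le (y*y*y*y), Nat.zero_le (y*y*y)]
    · have hp4 : p ≤ 4 := by omega
      interval_cases p
      · have : s = 0 := by omega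
        subst this; nlinarith
      · have : s = 0 := by omega
        subst this
        have : 5 ≤ d := by omega
        nlinarith
      · have : s = 0 := by omega
        subst this; nlinarith
      · have : s = 0 ∨ s = 1 := by omega
        have : 11 ≤ d := by omega
        rcases ‹s = 0 ∨ s = 1› with rfl | rfl <;> nlinarith
  have hph : p ≤ h := by omega
  have hr : ((p:ℝ)+1)*(h+1) + ((h:ℝ)-p)*((s+1)*p) ≤ ((h:ℝ)-p)*(h+1) := by
    rw [← Nat.cast_sub hph]; exact_mod_cast hnat
  push_cast at b
  rw [← add_assoc] at b
  have hd : (0:ℝ) < (h:ℝ) - p := by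
    have : (p:ℝ) + 1 ≤ h := by exact_mod_cast (show p + 1 ≤ h by omega)
    linarith
  have hX : (0:ℝ) ≤ (Nat.choose (h+s+1) p : ℝ) := by positivity
  have k1 := mul_le_mul_of_nonneg_left b hd.le
  have k2 := mul_le_mul_of_nonneg_left hr hX
  have key : (Nat.choose (h+s+1) p : ℝ) * (((p:ℝ)+1)*(h+1)) ≤
      (Nat.choose h (p+1) : ℝ) * (((p:ℝ)+1)*(h+1)) := by
    have : (Nat.choose h (p+1) : ℝ) * (((p:ℝ)+1)*(h+1)) = ((h:ℝ) - p) * ((h+1) * Nat.choose h p) := by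
      linear_combination ((h:ℝ)+1) * c
    rw [this]
    refine le_trans ?_ k1
    linarith
  exact_mod_cast le_of_mul_le_mul_right key (by positivity)

lemma lr_case1 (p h s l : ℕ) (h2 : 2 * (p + 1) ≤ h) (hp : 1 ≤ p)
    (h3 : (p+1) * (p+2) ≤ 2 * h + 2) (hl : p + 2 ≤ l) (hs : l + s = h) :
    min (Nat.choose (h+s+1) p) (Nat.choose l (p+2)) ≤ Nat.choose h (p+1) := by
  by_cases h4 : p + 1 ≤ 4 * s
  · exact lr_case1_large p h s l h2 hp h3 hl hs h4
  by_cases e1 : p = 2 ∧ h = 6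
  · obtain ⟨rfl, rfl⟩ := e1
    have : s = 0 := by omega
    have : l = 6 := by omega
    subst_vars; decide
  by_cases e2 : p = 4 ∧ h = 14
  · obtain ⟨rfl, rfl⟩ := e2
    have : s = 0 ∨ s = 1 := by omega
    apply (min_le_left _ _).trans
    rcases this with rfl | rfl <;> decide
  exact (min_le_left _ _).trans (lr_case1_small p h s h2 hp h3 (by omega) e1 e2)

lemma lr_core (r h p q k l : ℕ) (h2 : 2 * r ≤ h) (h3 : r * (r+1) ≤ 2 * h + 2)
    (hp : 1 ≤ p) (hpq : p ≤ q) (hr : p + q = 2 * r) (hkl : k + l ≤ 2 * h + 1) :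
    min (Nat.choose k p) (Nat.choose l q) ≤ Nat.choose h r := by
  by_cases hl : l < q
  · rw [Nat.choose_eq_zero_of_lt hl]; simp
  push Not at hl
  by_cases hk : k ≤ h
  · refine (min_le_left _ _).trans ((Nat.choose_le_choose p hk).trans ?_)
    obtain ⟨j, rfl⟩ : ∃ j, r = p + j := ⟨r - p, by omega⟩
    exact lr_mono_half h p j h2
  push Not at hk
  have hlh : l ≤ h := by omega
  obtain ⟨s, hs⟩ : ∃ s, l + s = h := ⟨h - l, by omega⟩
  have hk2 : k ≤ h + s + 1 := by omega
  refine (min_le_min_right _ (Nat.choose_le_choose p hk2)).trans ?_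
  obtain ⟨j, rfl⟩ : ∃ j, r = p + j := ⟨r - p, by omega⟩
  match j with
  | 0 =>
    have : q = p := by omega
    subst this
    exact (min_le_right _ _).trans (Nat.choose_le_choose q hlh)
  | 1 =>
    have : q = p + 2 := by omega
    subst this
    exact lr_case1 p h s l h2 hp h3 hl hs
  | j + 2 =>
    have : q = p + 4 + 2 * j := by omega
    subst this
    exact lr_case2 p j h s l (by omega) h3 hl hs

/-- for an odd integer `m ≥ 3` and an integer `n` with `n ≥ 2m - 1` and
`n ≥ m²/4 - 1`,
`max_{1 ≤ p ≤ m-2} max_{p ≤ k ≤ n-m+p} min (C(k,p)) (C(n-k-1, m-p-1))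
  = C(⌊(n-1)/2⌋, (m-1)/2)`. -/
theorem largest_rank_odd_order
    (m n : ℕ) (hm : 3 ≤ m) (hodd : Odd m) (hn1 : 2 * m - 1 ≤ n)
    (hn2 : (m : ℝ) ^ 2 / 4 - 1 ≤ (n : ℝ)) :
    ((Finset.Icc 1 (m - 2)).sup fun p =>
        (Finset.Icc p (n - m + p)).sup fun k =>
          min (Nat.choose k p) (Nat.choose (n - k - 1) (m - p - 1))) =
      Nat.choose ((n - 1) / 2) ((m - 1) / 2) := by
  obtain ⟨r, rfl⟩ := hodd
  have hr : (2 * r + 1 - 1) / 2 = r := by omega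
  rw [hr]
  have hsq : (2*r+1)^2 ≤ 4 * n + 4 := by
    have : ((2*(r:ℝ)+1))^2 ≤ 4 * n + 4 := by push_cast at hn2; linarith
    exact_mod_cast this
  obtain ⟨h, hh⟩ : ∃ h, h = (n-1)/2 := ⟨_, rfl⟩
  rw [← hh]
  obtain ⟨c, hc⟩ := Nat.even_mul_succ_self r
  have h3 : r * (r+1) ≤ 2 * h + 2 := by
    have : 4 * (r*(r+1)) + 1 ≤ 4 * n + 4 := by nlinarith
    omega
  apply le_antisymm
  · apply Finset.sup_le
    intro p hp
    apply Finset.sup_le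
    intro k hk
    rw [Finset.mem_Icc] at hp hk
    by_cases hpr : p ≤ r
    · exact lr_core r h p _ k _ (by omega) h3 hp.1 (by omega) (by omega) (by omega)
    · rw [min_comm]
      exact lr_core r h _ p _ k (by omega) h3 (by omega) (by omega) (by omega) (by omega)
  · have a1 : r ∈ Finset.Icc 1 (2 * r + 1 - 2) := by rw [Finset.mem_Icc]; omega
    have a2 : h ∈ Finset.Icc r (n - (2*r+1) + r) := by rw [Finset.mem_Icc]; omega
    refine le_trans ?_ (Finset.le_sup (f := fun p => (Finset.Icc p (n - (2*r+1) + p)).sup fun k =>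
          min (Nat.choose k p) (Nat.choose (n - k - 1) (2*r+1 - p - 1))) a1)
    refine le_trans ?_ (Finset.le_sup (f := fun k =>
          min (Nat.choose k r) (Nat.choose (n - k - 1) (2*r+1 - r - 1))) a2)
    have e : 2*r+1-r-1 = r := by omega
    simp only [e]
    exact le_min le_rfl (Nat.choose_le_choose r (by omega))
end

section
/- Let m ≥ 5 and n be integers with n ≥ 2m−1 and n ≥ m²/4 − 1. For each integer p with 1 ≤ p ≤ ⌊(m−1)/2⌋, let k_p be the largest integer k ∈ [p, n−m+p] such that C(k, p) ≤ C(n−k−1, m−p−1), and set r_p = max(C(k_p, p), C(n−k_p−2, m−p−1)). Then for every integer p with 2 ≤ p ≤ ⌊(m−1)/2⌋ it holds that r_{p−1} ≤ r_p. -/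
/-- Multiplicative step of a binomial coefficient, over the reals. -/
lemma choose_step (x k : ℕ) (h : k ≤ x) :
    ((x + 1).choose k : ℝ) * ((x : ℝ) + 1 - k) = (x.choose k : ℝ) * ((x : ℝ) + 1) := by
  have h1 := Nat.choose_mul_succ_eq x k
  have h2 : ((x + 1 - k : ℕ) : ℝ) = (x : ℝ) + 1 - k := by
    rw [Nat.cast_sub (by omega)]; push_cast; ring
  rw [← h2]
  exact_mod_cast h1.symm

lemma choose_up (x k : ℕ) (h : k ≤ x) :
    (x.choose (k + 1) : ℝ) * ((k : ℝ) + 1) = (x.choose k : ℝ) * ((x : ℝ) - k) := by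
  have h1 := Nat.choose_succ_right_eq x k
  rw [← Nat.cast_sub h]
  exact_mod_cast h1

/-- Growth of `C(d+1+t, P)` relative to `d+1` is at most that of `C(b+t, q)` relative to `b`. -/
lemma growth_compare (P q b d t : ℕ) (hPq : P ≤ q) (hqb : q ≤ b) (hbd : b ≤ d) :
    ((d + 1 + t).choose P : ℝ) * (b.choose q : ℝ)
      ≤ ((b + t).choose q : ℝ) * ((d + 1).choose P : ℝ) := by
  induction t with
  | zero => simp [mul_comm]
  | succ t ih =>
    have h1 := choose_step (d + 1 + t) P (by omega)
    have h2 := choose_step (b + t) q (by omega)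
    rw [← add_assoc, ← add_assoc]
    have hP : (P : ℝ) ≤ q := by exact_mod_cast hPq
    have hq : (q : ℝ) ≤ b := by exact_mod_cast hqb
    have hb : (b : ℝ) ≤ d := by exact_mod_cast hbd
    have hP0 : (0 : ℝ) ≤ P := by positivity
    have ht0 : (0 : ℝ) ≤ t := by positivity
    push_cast at h1 h2
    have e1 : ((d + 1 + t + 1).choose P : ℝ)
        = ((d + 1 + t).choose P : ℝ) * (((d : ℝ) + 1 + t + 1) / ((d : ℝ) + 1 + t + 1 - P)) := by
      rw [← mul_div_assoc, ← h1, mul_div_cancel_right₀]; linarith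
    have e2 : ((b + t + 1).choose q : ℝ)
        = ((b + t).choose q : ℝ) * (((b : ℝ) + t + 1) / ((b : ℝ) + t + 1 - q)) := by
      rw [← mul_div_assoc, ← h2, mul_div_cancel_right₀]; linarith
    have hr : ((d : ℝ) + 1 + t + 1) / ((d : ℝ) + 1 + t + 1 - P)
        ≤ ((b : ℝ) + t + 1) / ((b : ℝ) + t + 1 - q) := by
      rw [div_le_div_iff₀ (by linarith) (by linarith)]
      nlinarith
    rw [e1, e2]
    calc _ = (((d + 1 + t).choose P : ℝ) * (b.choose q : ℝ)) *
          (((d : ℝ) + 1 + t + 1) / ((d : ℝ) + 1 + t + 1 - P)) := by ring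
      _ ≤ (((b + t).choose q : ℝ) * ((d + 1).choose P : ℝ)) *
          (((b : ℝ) + t + 1) / ((b : ℝ) + t + 1 - q)) := by
        apply mul_le_mul ih hr
        · apply div_nonneg <;> linarith
        · positivity
      _ = _ := by ring

/-- First criterion. -/
lemma crit_one (P q b d t : ℕ) (hPq : P ≤ q) (hqb : q < b) (hbd : b ≤ d)
    (hH : (b + t).choose q < b.choose (q + 1))
    (hA : ((b : ℝ) - q) * ((P : ℝ) + 1) * ((d : ℝ) + 1)
      ≤ ((d : ℝ) - P) * ((d : ℝ) - P + 1) * ((q : ℝ) + 1)) :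
    (d + t + 1).choose P ≤ d.choose (P + 1) := by
  have g := growth_compare P q b d t hPq hqb.le hbd
  have h1 := choose_step d P (by omega)
  have h2 := choose_up d P (by omega)
  have h3 := choose_up b q hqb.le
  have hH' : ((b + t).choose q : ℝ) ≤ (b.choose (q + 1) : ℝ) := by exact_mod_cast hH.le
  have hc : (0 : ℝ) < b.choose q := by exact_mod_cast Nat.choose_pos hqb.le
  have hP : (P : ℝ) ≤ q := by exact_mod_cast hPq
  have hq : (q : ℝ) < b := by exact_mod_cast hqb
  have hb : (b : ℝ) ≤ d := by exact_mod_cast hbd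
  have hP0 : (0 : ℝ) ≤ P := by positivity
  have hdP : (0 : ℝ) < d.choose P := by exact_mod_cast Nat.choose_pos (by omega)
  have e1 : ((d + 1).choose P : ℝ) = (d.choose P : ℝ) * (((d : ℝ) + 1) / ((d : ℝ) - P + 1)) := by
    rw [← mul_div_assoc, ← h1, show (d : ℝ) + 1 - P = d - P + 1 by ring, mul_div_cancel_right₀]
    linarith
  have e2 : (d.choose (P + 1) : ℝ) = (d.choose P : ℝ) * (((d : ℝ) - P) / ((P : ℝ) + 1)) := by
    rw [← mul_div_assoc, ← h2, mul_div_cancel_right₀]; linarith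
  have e3 : (b.choose (q + 1) : ℝ) = (b.choose q : ℝ) * (((b : ℝ) - q) / ((q : ℝ) + 1)) := by
    rw [← mul_div_assoc, ← h3, mul_div_cancel_right₀]; linarith
  have hr : (((b : ℝ) - q) / ((q : ℝ) + 1)) * (((d : ℝ) + 1) / ((d : ℝ) - P + 1))
      ≤ ((d : ℝ) - P) / ((P : ℝ) + 1) := by
    rw [div_mul_div_comm, div_le_div_iff₀ (by apply mul_pos <;> linarith) (by linarith)]
    linarith
  have key : ((d + 1 + t).choose P : ℝ) * (b.choose q : ℝ)
      ≤ (d.choose (P + 1) : ℝ) * (b.choose q : ℝ) := by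
    calc _ ≤ _ := g
      _ ≤ (b.choose (q + 1) : ℝ) * ((d + 1).choose P : ℝ) :=
        mul_le_mul_of_nonneg_right hH' (by positivity)
      _ = ((b.choose q : ℝ) * (d.choose P : ℝ)) *
          ((((b : ℝ) - q) / ((q : ℝ) + 1)) * (((d : ℝ) + 1) / ((d : ℝ) - P + 1))) := by
        rw [e3, e1]; ring
      _ ≤ ((b.choose q : ℝ) * (d.choose P : ℝ)) * (((d : ℝ) - P) / ((P : ℝ) + 1)) :=
        mul_le_mul_of_nonneg_left hr (by positivity)
      _ = _ := by rw [e2]; ring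
  have := le_of_mul_le_mul_right key hc
  rw [show d + t + 1 = d + 1 + t by ring]
  exact_mod_cast this

/-- Second criterion. -/
lemma crit_two (P d t : ℕ) (hd : P ≤ d)
    (hA : (1 + (P : ℝ) / ((d : ℝ) - P + 1)) ^ (t + 1) ≤ ((d : ℝ) - P) / ((P : ℝ) + 1)) :
    (d + t + 1).choose P ≤ d.choose (P + 1) := by
  have hd' : (P : ℝ) ≤ d := by exact_mod_cast hd
  have hP0 : (0 : ℝ) ≤ P := by positivity
  have main : ∀ s : ℕ, ((d + s).choose P : ℝ)
      ≤ (d.choose P : ℝ) * (1 + (P : ℝ) / ((d : ℝ) - P + 1)) ^ s := by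
    intro s
    induction s with
    | zero => simp
    | succ s ih =>
      have hs0 : (0 : ℝ) ≤ s := by positivity
      have h1 := choose_step (d + s) P (by omega)
      push_cast at h1
      have e1 : ((d + s + 1).choose P : ℝ)
          = ((d + s).choose P : ℝ) * (1 + (P : ℝ) / ((d : ℝ) + s + 1 - P)) := by
        have : 1 + (P : ℝ) / ((d : ℝ) + s + 1 - P)
            = ((d : ℝ) + s + 1) / ((d : ℝ) + s + 1 - P) := by
          have : (d : ℝ) + s + 1 - P ≠ 0 := by linarith
          field_simp
          ring
        rw [this, ← mul_div_assoc, ← h1, mul_div_cancel_right₀]; linarith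
      rw [← add_assoc, e1, pow_succ, ← mul_assoc]
      apply mul_le_mul ih
      · gcongr
        linarith
      · have : 0 ≤ (P : ℝ) / ((d : ℝ) + s + 1 - P) := div_nonneg hP0 (by linarith)
        linarith
      · have : 0 ≤ (P : ℝ) / ((d : ℝ) - P + 1) := div_nonneg hP0 (by linarith)
        positivity
  have h2 := choose_up d P hd
  have e2 : (d.choose (P + 1) : ℝ) = (d.choose P : ℝ) * (((d : ℝ) - P) / ((P : ℝ) + 1)) := by
    rw [← mul_div_assoc, ← h2, mul_div_cancel_right₀]; linarith
  have : ((d + (t + 1)).choose P : ℝ) ≤ (d.choose (P + 1) : ℝ) := by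
    rw [e2]
    exact (main (t + 1)).trans (mul_le_mul_of_nonneg_left hA (by positivity))
  exact_mod_cast this

/-- What failure of the first criterion gives. Here `p` the smaller index, `q = p + g`. -/
lemma fail_bounds (p g B D t : ℝ) (hp : 0 ≤ p) (hg : 0 ≤ g) (ht : 0 ≤ t) (hB : 0 < B)
    (hD : B + g + 1 + t ≤ D)
    (hF : D * (D + 1) * (p + g + 1) < B * p * (D + p)) :
    B * (g + 1) + (p + g + 1) * (g + 2 + t) < p ^ 2 ∧
    D * (g + 1) + (p + g + 1) * (g + 2 + t) < p ^ 2 := by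
  have hDB : B ≤ D := by linarith
  have hD0 : 0 < D := by linarith
  have hE : D * (B * (g + 1) + (p + g + 1) * (g + 2 + t)) < B * p ^ 2 := by
    have : 0 ≤ D * ((p + g + 1) * (D - (B + g + 1 + t))) := by
      apply mul_nonneg hD0.le
      apply mul_nonneg <;> linarith
    nlinarith
  have hw : 0 ≤ (p + g + 1) * (g + 2 + t) := by positivity
  have hE0 : 0 ≤ B * (g + 1) := by positivity
  constructor
  · have : B * (B * (g + 1) + (p + g + 1) * (g + 2 + t)) < B * p ^ 2 :=
      lt_of_le_of_lt (mul_le_mul_of_nonneg_right hDB (by linarith)) hE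
    exact lt_of_mul_lt_mul_left this hB.le
  · have : B * (D * (g + 1) + (p + g + 1) * (g + 2 + t)) < B * p ^ 2 := by
      have := mul_le_mul_of_nonneg_right hDB hw
      nlinarith
    exact lt_of_mul_lt_mul_left this hB.le

lemma pow_le_three (k : ℕ) (x : ℝ) (hx : 0 ≤ x) (hk : x * k ≤ 1) : (1 + x) ^ k ≤ 3 := by
  have h1 : (1 + x) ^ k ≤ (Real.exp x) ^ k := by
    apply pow_le_pow_left₀ (by linarith)
    linarith [Real.add_one_le_exp x]
  rw [← Real.exp_nat_mul] at h1
  have h2 : Real.exp (k * x) ≤ Real.exp 1 := Real.exp_le_exp.mpr (by linarith)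
  have h3 := Real.exp_one_lt_d9
  linarith

/-- The key inequality. -/
lemma key_ineq (P q b d t : ℕ) (hP : 1 ≤ P) (hPq : P + 1 ≤ q) (hb : 2 * q + 2 ≤ b)
    (hd : b + t ≤ d) (hN : (P + q + 2) ^ 2 ≤ 4 * (d + b + t) + 12)
    (hH : (b + t).choose q < b.choose (q + 1)) :
    (d + t + 1).choose P ≤ d.choose (P + 1) := by
  by_cases hA : ((b : ℝ) - q) * ((P : ℝ) + 1) * ((d : ℝ) + 1)
      ≤ ((d : ℝ) - P) * ((d : ℝ) - P + 1) * ((q : ℝ) + 1)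
  · exact crit_one P q b d t (by omega) (by omega) (by omega) hH hA
  push Not at hA
  obtain ⟨g, rfl⟩ := Nat.exists_eq_add_of_le hPq
  have hbR : 2 * ((P : ℝ) + 1 + g) + 2 ≤ b := by exact_mod_cast hb
  have hdR : (b : ℝ) + t ≤ d := by exact_mod_cast hd
  have hNR : ((P : ℝ) + (P + 1 + g) + 2) ^ 2 ≤ 4 * ((d : ℝ) + b + t) + 12 := by exact_mod_cast hN
  have hPR : (1 : ℝ) ≤ P := by exact_mod_cast hP
  have ht0 : (0 : ℝ) ≤ t := by positivity
  have hg0 : (0 : ℝ) ≤ g := by positivity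
  push_cast at hA
  obtain ⟨f1, f2⟩ := fail_bounds ((P : ℝ) + 1) g ((b : ℝ) - (P + 1 + g)) ((d : ℝ) - P) t
    (by linarith) hg0 ht0 (by linarith) (by linarith) (by linarith)
  rcases Nat.eq_zero_or_pos g with hg | hg
  · subst hg
    simp only [Nat.cast_zero, add_zero, zero_add] at *
    -- now `q = P + 1`
    apply crit_two P d t (by omega)
    have hNn : P ^ 2 + 3 * P ≤ d + b + t := by nlinarith
    have hNn' : (P : ℝ) ^ 2 + 3 * P ≤ d + b + t := by exact_mod_cast hNn
    have hD1 : ((P : ℝ) + 2) * (t + 1) + 1 ≤ (d : ℝ) - P := by nlinarith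
    have hD2 : ((P : ℝ) + 1) * P ≤ 2 * ((d : ℝ) - P) := by nlinarith
    have hDpos : (0 : ℝ) < (d : ℝ) - P + 1 := by nlinarith
    have hx0 : 0 ≤ (P : ℝ) / ((d : ℝ) - P + 1) := by positivity
    have hxk : (P : ℝ) / ((d : ℝ) - P + 1) * ((t + 1 : ℕ) : ℝ) ≤ 1 := by
      rw [div_mul_eq_mul_div, div_le_one hDpos]
      push_cast
      nlinarith
    have h3 := pow_le_three (t + 1) _ hx0 hxk
    by_cases hbig : 3 ≤ ((d : ℝ) - P) / ((P : ℝ) + 1)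
    · exact h3.trans hbig
    · rw [le_div_iff₀ (by linarith)] at hbig
      push Not at hbig
      have ht2 : t < 2 := by
        by_contra hcon
        have : (2 : ℝ) ≤ t := by exact_mod_cast (not_lt.mp hcon)
        nlinarith
      have hP5 : P < 6 := by
        have : (P : ℝ) < 6 := by nlinarith
        exact_mod_cast this
      have hP5' : (P : ℝ) ≤ 5 := by exact_mod_cast (by omega : P ≤ 5)
      interval_cases t
      · simp only [Nat.cast_zero, zero_add, pow_one, add_zero, mul_one] at *
        rw [show 1 + (P : ℝ) / ((d : ℝ) - P + 1) = ((d : ℝ) + 1) / ((d : ℝ) - P + 1) by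
          field_simp; ring, div_le_div_iff₀ hDpos (by linarith)]
        nlinarith
      · exfalso
        norm_num at f2
        nlinarith [mul_nonneg (sub_nonneg.mpr hP5') (by linarith : (0 : ℝ) ≤ (P : ℝ) + 2)]
  · have hg1 : (1 : ℝ) ≤ g := by exact_mod_cast hg
    exfalso
    nlinarith

lemma choose_ge (q : ℕ) (hq : 1 ≤ q) (r : ℕ) : r ≤ (r + q).choose q := by
  obtain ⟨k, rfl⟩ := Nat.exists_eq_add_of_le' hq
  induction r with
  | zero => simp
  | succ r ih =>
    have h : (r + 1 + (k + 1)).choose (k + 1)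
        = (r + 1 + k).choose k + (r + (k + 1)).choose (k + 1) := by
      rw [show r + 1 + (k + 1) = (r + 1 + k) + 1 by ring, Nat.choose_succ_succ,
        show r + 1 + k = r + (k + 1) by ring]
    have : 0 < (r + 1 + k).choose k := Nat.choose_pos (by omega)
    omega

lemma choose_le_up (a P : ℕ) (h : 2 * P + 1 ≤ a) : a.choose P ≤ a.choose (P + 1) := by
  have h1 := Nat.choose_succ_right_eq a P
  have h2 : P + 1 ≤ a - P := by omega
  have h3 : a.choose P * (P + 1) ≤ a.choose (P + 1) * (P + 1) := by
    rw [h1]; exact Nat.mul_le_mul_left _ h2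
  exact Nat.le_of_mul_le_mul_right h3 (by omega)

lemma choose_up_le (b q : ℕ) (h : b ≤ 2 * q + 1) : b.choose (q + 1) ≤ b.choose q := by
  have h1 := Nat.choose_succ_right_eq b q
  have h2 : b - q ≤ q + 1 := by omega
  have h3 : b.choose (q + 1) * (q + 1) ≤ b.choose q * (q + 1) := by
    rw [h1]; exact Nat.mul_le_mul_left _ h2
  exact Nat.le_of_mul_le_mul_right h3 (by omega)

lemma choose_mono_low (c p q : ℕ) (hpq : p ≤ q) (h : 2 * q ≤ c + 1) :
    c.choose p ≤ c.choose q := by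
  induction q, hpq using Nat.le_induction with
  | base => exact le_rfl
  | succ k hk ih => exact (ih (by omega)).trans (choose_le_up c k (by omega))

lemma exists_split (P q N a b r : ℕ) (hP : 1 ≤ P) (hPq : P + 1 ≤ q) (hab : a + b = N)
    (hN1 : 2 * (P + q + 1) ≤ N) (hN2 : (P + q + 2) ^ 2 ≤ 4 * N + 8)
    (hra : r ≤ a.choose P) (hrb : r ≤ b.choose (q + 1)) :
    ∃ u v : ℕ, u + v ≤ N ∧ r ≤ v.choose (P + 1) ∧ r ≤ u.choose q := by
  classical
  have hu : ∃ u : ℕ, r ≤ u.choose q := ⟨_, choose_ge q (by omega) r⟩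
  have hv : ∃ v : ℕ, r ≤ v.choose (P + 1) := ⟨_, choose_ge (P + 1) (by omega) r⟩
  refine ⟨Nat.find hu, Nat.find hv, ?_, Nat.find_spec hv, Nat.find_spec hu⟩
  by_cases hub : Nat.find hu ≤ b
  · by_cases ha : 2 * P + 1 ≤ a
    · have := Nat.find_min' hv (hra.trans (choose_le_up a P ha))
      omega
    · have e0 : r ≤ (2 * P + 1).choose P := hra.trans (Nat.choose_le_choose P (by omega))
      have e1 := Nat.find_min' hv (e0.trans (choose_le_up (2 * P + 1) P le_rfl))
      have e2 : (2 * P + 1).choose P ≤ (2 * q + 1).choose q :=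
        (Nat.choose_le_choose P (by omega)).trans
          (choose_mono_low (2 * q + 1) P q (by omega) (by omega))
      have e3 := Nat.find_min' hu (e0.trans e2)
      omega
  · by_contra hcon
    obtain ⟨t, ht⟩ : ∃ t, Nat.find hu = b + t + 1 := ⟨Nat.find hu - b - 1, by omega⟩
    have hbt : (b + t).choose q < r := by
      have := Nat.find_min hu (m := b + t) (by omega)
      omega
    have hbq : 2 * q + 2 ≤ b := by
      by_contra h
      have h1 := choose_up_le b q (by omega)
      have h2 : b.choose q ≤ (b + t).choose q := Nat.choose_le_choose q (by omega)
      omega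
    have hvpos : b + t < Nat.find hv := by
      by_contra h
      have h1 := Nat.find_spec hv
      have h2 : (Nat.find hv).choose (P + 1) ≤ (b + t).choose (P + 1) :=
        Nat.choose_le_choose _ (by omega)
      have h3 := choose_mono_low (b + t) (P + 1) q hPq (by omega)
      omega
    obtain ⟨d, hd⟩ : ∃ d, Nat.find hv = d + 1 := ⟨Nat.find hv - 1, by omega⟩
    have hdr : d.choose (P + 1) < r := by
      have := Nat.find_min hv (m := d) (by omega)
      omega
    have hk := key_ineq P q b d t hP hPq hbq (by omega) (by omega) (by omega)
    have h2 : a.choose P ≤ (d + t + 1).choose P := Nat.choose_le_choose _ (by omega)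
    omega

/-- let `m ≥ 5` and `n` be integers with `n ≥ 2m - 1` and `n ≥ m²/4 - 1`.
For each integer `p ∈ [1, ⌊(m-1)/2⌋]`, let `kf p` be the largest integer
`k ∈ [p, n - m + p]` with `C(k,p) ≤ C(n-k-1, m-p-1)`, and set
`r_p = max (C(kf p, p)) (C(n - kf p - 2, m - p - 1))`.  Then `r_{p-1} ≤ r_p` for every
integer `p ∈ [2, ⌊(m-1)/2⌋]`. -/
theorem rank_monotone_in_p
    (m n : ℕ) (hm : 5 ≤ m) (hn1 : 2 * m - 1 ≤ n)
    (hn2 : (m : ℝ) ^ 2 / 4 - 1 ≤ (n : ℝ))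
    (kf : ℕ → ℕ)
    (hkf : ∀ p : ℕ, 1 ≤ p → p ≤ (m - 1) / 2 →
      p ≤ kf p ∧ kf p ≤ n - m + p ∧
        Nat.choose (kf p) p ≤ Nat.choose (n - kf p - 1) (m - p - 1) ∧
        ∀ k : ℕ, p ≤ k → k ≤ n - m + p →
          Nat.choose k p ≤ Nat.choose (n - k - 1) (m - p - 1) → k ≤ kf p) :
    ∀ p : ℕ, 2 ≤ p → p ≤ (m - 1) / 2 →
      max (Nat.choose (kf (p - 1)) (p - 1))
          (Nat.choose (n - kf (p - 1) - 2) (m - (p - 1) - 1)) ≤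
        max (Nat.choose (kf p) p) (Nat.choose (n - kf p - 2) (m - p - 1)) := by
  intro p hp hpm
  obtain ⟨P, rfl⟩ : ∃ P, p = P + 1 := ⟨p - 1, by omega⟩
  simp only [Nat.add_sub_cancel]
  obtain ⟨q, hq⟩ : ∃ q, m = P + 1 + q + 1 := ⟨m - P - 2, by omega⟩
  have hPq : P + 1 ≤ q := by omega
  have hN2 : (P + q + 2) ^ 2 ≤ 4 * (n - 1) + 8 := by
    have h1 : (m : ℝ) ^ 2 ≤ 4 * n + 4 := by linarith
    have h2 : m ^ 2 ≤ 4 * n + 4 := by exact_mod_cast h1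
    rw [hq, show P + 1 + q + 1 = P + q + 2 by ring] at h2
    omega
  obtain ⟨hk1, hk2, hk3, hk4⟩ := hkf P (by omega) (by omega)
  have e1 : m - P - 1 = q + 1 := by omega
  have e2 : m - (P + 1) - 1 = q := by omega
  rw [e1] at hk3 hk4 ⊢
  rw [e2]
  have fin : ∀ r a b : ℕ, a + b = n - 1 → r ≤ a.choose P → r ≤ b.choose (q + 1) →
      r ≤ max ((kf (P + 1)).choose (P + 1)) ((n - kf (P + 1) - 2).choose q) := by
    intro r a b hab ha hb
    obtain ⟨u, v, huv, hv, hu⟩ := exists_split P q (n - 1) a b r (by omega) hPq hab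
      (by omega) hN2 ha hb
    by_cases h : v ≤ kf (P + 1)
    · exact le_max_of_le_left (hv.trans (Nat.choose_le_choose _ h))
    · exact le_max_of_le_right (hu.trans (Nat.choose_le_choose _ (by omega)))
  apply max_le
  · exact fin _ (kf P) (n - kf P - 1) (by omega) le_rfl hk3
  · by_cases hlast : kf P + 1 ≤ n - m + P
    · have h := hk4 (kf P + 1) (by omega) hlast
      have e3 : n - (kf P + 1) - 1 = n - kf P - 2 := by omega
      rw [e3] at h
      refine fin _ (kf P + 1) (n - kf P - 2) (by omega) ?_ le_rfl
      by_contra hc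
      have := h (by omega)
      omega
    · rw [Nat.choose_eq_zero_of_lt (by omega)]
      exact Nat.zero_le _
end
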